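/- If G is a graph with B(G) = 2, then G is one of: (1) a star K_{1,t} with t ≥ 2; (2) a connected bipartite graph on 6 vertices with parts of size 3; (3) P_4, P_4 + K_1, or P_4 + K_2; (4) C_4, C_4 + K_1, or C_4 + K_2; (5) C_5; (6) K_2 + K_2 or K_2 + K_2 + K_2; (7) K_3 + K_2; (8) K_3 + K_3; (9) K_2 + K_2 + K_1; (10) a graph on at least 4 vertices having a vertex v of degree 0 or 1 with G − v complete; (11) P_3 + rK_1 with r ≥ 1; (12) K_2 + rK_1 with r ≥ 1. -/

import Mathlib

open Finset

variable {V : Type*}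

/-- A proper coloring given as a function to ℕ. -/
def IsProperColoring (G : SimpleGraph V) (c : V → ℕ) : Prop :=
  ∀ ⦃u v⦄, G.Adj u v → c u ≠ c v

variable [Fintype V] [DecidableEq V]

/-- Two colorings use every color the same number of times. -/
def SameColorCounts (c c' : V → ℕ) : Prop :=
  ∀ k : ℕ, (univ.filter fun v => c v = k).card = (univ.filter fun v => c' v = k).card

/-- The number of vertices on which two colorings differ. -/
def recolorCount (c c' : V → ℕ) : ℕ := (univ.filter fun v => c v ≠ c' v).card

/-- The ℕ-valued chromatic number. -/
noncomputable def chromNum (G : SimpleGraph V) : ℕ := G.chromaticNumber.toNat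

/-- A proper coloring of `G` using exactly `χ(G)` colors. -/
noncomputable def IsOptimalColoring (G : SimpleGraph V) (f : V → ℕ) : Prop :=
  IsProperColoring G f ∧ (univ.image f).card = chromNum G

/-- The villainy of a coloring `c`: the least number of vertices that must be
recolored to obtain a proper coloring using each color as often as `c` does. -/
noncomputable def colVillainy (G : SimpleGraph V) (c : V → ℕ) : ℕ :=
  sInf {n | ∃ c', IsProperColoring G c' ∧ SameColorCounts c c' ∧ recolorCount c c' = n}

/-- `c` is a permutation of the coloring `f`. -/
def IsPermutationOf (c f : V → ℕ) : Prop := ∃ σ : Equiv.Perm V, c = f ∘ σ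

/-- The villainy of `G`: the maximum villainy over all permutations of optimal
proper colorings of `G`. -/
noncomputable def villainy (G : SimpleGraph V) : ℕ :=
  sSup {n | ∃ f c, IsOptimalColoring G f ∧ IsPermutationOf c f ∧ colVillainy G c = n}

/-- The star `K_{1,t}` with center `0` and `t` leaves. -/
def starGraph (t : ℕ) : SimpleGraph (Fin (t + 1)) :=
  SimpleGraph.fromRel fun a _ => a = 0


set_option linter.unusedSectionVars false

theorem exists_oddcycle (G : SimpleGraph V) (h : ¬ G.Colorable 2) :
    (∃ a b c, G.Adj a b ∧ G.Adj b c ∧ G.Adj c a) ∨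
    (∃ a b c d e, [a, b, c, d, e].Nodup ∧ G.Adj a b ∧ G.Adj b c ∧ G.Adj c d ∧ G.Adj d e ∧
      G.Adj e a) ∨
    (∃ a b c d e g x, [a, b, c, d, e, g, x].Nodup ∧ G.Adj a b ∧ G.Adj c d ∧ G.Adj e g) := by
  classical
  rw [SimpleGraph.two_colorable_iff_forall_loop_even] at h
  push Not at h
  have hex : ∃ n : ℕ, ∃ u, ∃ w : G.Walk u u, w.length = n ∧ Odd n := by
    obtain ⟨u, w, hw⟩ := h
    exact ⟨_, u, w, rfl, by simpa using hw⟩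
  obtain ⟨u, w, hwl, hodd⟩ := Nat.find_spec hex
  have hmin := fun m (hm : m < Nat.find hex) => Nat.find_min hex hm
  generalize Nat.find hex = L at *
  have hadj : ∀ i, i < L → G.Adj (w.getVert i) (w.getVert (i + 1)) := fun i hi =>
    w.adj_getVert_succ (by omega)
  have hinj : ∀ i j, i < j → j < L → w.getVert i ≠ w.getVert j := by
    intro i j hij hj he
    by_cases hp : Odd (j - i)
    · apply hmin (j - i) (by omega)
      have h1 : (w.drop i).getVert (j - i) = w.getVert i := by
        rw [SimpleGraph.Walk.drop_getVert, he]; congr 1; omega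
      refine ⟨w.getVert i, ((w.drop i).take (j - i)).copy rfl h1, ?_, hp⟩
      simp [SimpleGraph.Walk.take_length, SimpleGraph.Walk.drop_length]; omega
    · apply hmin (L - (j - i)) (by omega)
      refine ⟨u, (w.take i).append ((w.drop j).copy he.symm rfl), ?_, ?_⟩
      · simp [SimpleGraph.Walk.take_length, SimpleGraph.Walk.drop_length]; omega
      · rw [Nat.odd_iff] at *; omega
  have hL : w.getVert L = w.getVert 0 := by rw [← hwl]; simp
  have h3 : L = 1 ∨ L = 3 ∨ L = 5 ∨ 7 ≤ L := by rw [Nat.odd_iff] at hodd; omega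
  rcases h3 with rfl | rfl | rfl | h7
  · have := hadj 0 (by omega)
    simp only [zero_add] at this
    rw [hL] at this
    exact absurd this (G.loopless.irrefl _)
  · left
    refine ⟨_, _, _, hadj 0 (by omega), hadj 1 (by omega), ?_⟩
    rw [← hL]; exact hadj 2 (by omega)
  · right; left
    refine ⟨_, _, _, _, _, ?_, hadj 0 (by omega), hadj 1 (by omega), hadj 2 (by omega),
      hadj 3 (by omega), ?_⟩
    · have := fun i j h1 (h2 : j < 5) => hinj i j h1 h2
      simp [-SimpleGraph.Walk.getVert_zero, this]
    · rw [← hL]; exact hadj 4 (by omega)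
  · right; right
    refine ⟨_, _, _, _, _, _, w.getVert 6, ?_, hadj 0 (by omega), hadj 2 (by omega),
      hadj 4 (by omega)⟩
    have := fun i j h1 (h2 : j < 7) => hinj i j h1 (by omega)
    simp [-SimpleGraph.Walk.getVert_zero, this]

theorem colVillainy_bound (G : SimpleGraph V) (f : V → ℕ) (hf : IsProperColoring G f)
    (σ : Equiv.Perm V) :
    ∃ c', IsProperColoring G c' ∧ SameColorCounts (f ∘ σ) c' ∧
      recolorCount (f ∘ σ) c' = colVillainy G (f ∘ σ) := by
  have : ({n | ∃ c', IsProperColoring G c' ∧ SameColorCounts (f ∘ σ) c' ∧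
      recolorCount (f ∘ σ) c' = n}).Nonempty := by
    refine ⟨_, f, hf, ?_, rfl⟩
    intro k
    refine Finset.card_bij (fun v _ => σ v) ?_ ?_ ?_
    · simp
    · simp
    · intro b hb
      exact ⟨σ.symm b, by simpa using hb, by simp⟩
  exact Nat.sInf_mem this

theorem swap_of_recolor (c c' : V → ℕ) (hs : SameColorCounts c c') (hr : recolorCount c c' ≤ 2) :
    c' = c ∨ ∃ x y, x ≠ y ∧ c' x = c y ∧ c' y = c x ∧ ∀ z, z = x ∨ z = y ∨ c' z = c z := by
  classical
  by_cases hcc : c' = c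
  · exact Or.inl hcc
  right
  have key : ∀ k, ((univ.filter fun v => c v ≠ c' v).filter fun v => c v = k).card =
      ((univ.filter fun v => c v ≠ c' v).filter fun v => c' v = k).card := by
    intro k
    have h1 := hs k
    have e1 := Finset.card_filter_add_card_filter_not (s := univ.filter fun v => c v = k)
      (fun v => c v ≠ c' v)
    have e2 := Finset.card_filter_add_card_filter_not (s := univ.filter fun v => c' v = k)
      (fun v => c v ≠ c' v)
    rw [Finset.filter_filter] at e1 e2 ⊢
    rw [Finset.filter_filter] at e1 e2 ⊢
    have e3 : (univ.filter fun v => c v = k ∧ ¬ (c v ≠ c' v)) =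
      (univ.filter fun v => c' v = k ∧ ¬ (c v ≠ c' v)) := by
      ext v; simp; grind
    have e4 : (univ.filter fun v => c v ≠ c' v ∧ c v = k) =
      (univ.filter fun v => c v = k ∧ (c v ≠ c' v)) := by
      ext v; simp; grind
    have e5 : (univ.filter fun v => c v ≠ c' v ∧ c' v = k) =
      (univ.filter fun v => c' v = k ∧ (c v ≠ c' v)) := by
      ext v; simp; grind
    rw [e4, e5]
    rw [e3] at e1
    omega
  unfold recolorCount at hr
  have hpos : 0 < (univ.filter fun v => c v ≠ c' v).card := by
    rw [Finset.card_pos]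
    by_contra hne
    rw [Finset.not_nonempty_iff_eq_empty] at hne
    apply hcc
    ext v
    have := Finset.filter_eq_empty_iff.mp hne (Finset.mem_univ v)
    grind
  have h12 : (univ.filter fun v => c v ≠ c' v).card = 1 ∨
    (univ.filter fun v => c v ≠ c' v).card = 2 := by omega
  have hmem : ∀ z, c z ≠ c' z ↔ z ∈ (univ.filter fun v => c v ≠ c' v) := by simp
  generalize (univ.filter fun v => c v ≠ c' v) = D at *
  rcases h12 with h | h
  · obtain ⟨x, rfl⟩ := Finset.card_eq_one.mp h
    have := key (c x)
    have h2 := hmem x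
    simp [Finset.filter_singleton] at this h2
    grind
  · obtain ⟨x, y, hxy, rfl⟩ := Finset.card_eq_two.mp h
    have k1 := key (c x)
    have k2 := key (c y)
    have h2 := hmem x
    have h3 := hmem y
    rw [Finset.card_filter, Finset.card_filter, Finset.sum_pair hxy, Finset.sum_pair hxy] at k1 k2
    simp only [Finset.mem_insert, Finset.mem_singleton, true_or, or_true, iff_true] at h2 h3
    refine ⟨x, y, hxy, ?_, ?_, fun z => ?_⟩
    · grind
    · grind
    · have := hmem z
      simp only [Finset.mem_insert, Finset.mem_singleton] at this
      grind

/-- the working form of villainy at most two -/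
def SwapProp (G : SimpleGraph V) : Prop :=
  ∀ f, IsOptimalColoring G f → ∀ σ : Equiv.Perm V, ∃ c', IsProperColoring G c' ∧
    (c' = f ∘ σ ∨ ∃ x y, x ≠ y ∧ c' x = f (σ y) ∧ c' y = f (σ x) ∧
      ∀ z, z = x ∨ z = y ∨ c' z = f (σ z))

theorem setup_swap (G : SimpleGraph V) (hB : villainy G = 2) :
    SwapProp G ∧ ∃ f, IsOptimalColoring G f ∧ ¬ Function.Injective f ∧ ∃ u v, G.Adj u v := by
  have hbdd : ∀ n ∈ {n | ∃ f c, IsOptimalColoring G f ∧ IsPermutationOf c f ∧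
      colVillainy G c = n}, n ≤ Fintype.card V := by
    rintro n ⟨f, c, hf, ⟨σ, rfl⟩, rfl⟩
    obtain ⟨c', h1, h2, h3⟩ := colVillainy_bound G f hf.1 σ
    rw [← h3]
    exact Finset.card_le_univ _
  constructor
  · intro f hf σ
    obtain ⟨c', h1, h2, h3⟩ := colVillainy_bound G f hf.1 σ
    refine ⟨c', h1, swap_of_recolor (f ∘ σ) c' h2 ?_⟩
    rw [h3, ← hB]
    exact le_csSup ⟨_, hbdd⟩ ⟨f, _, hf, ⟨σ, rfl⟩, rfl⟩
  · have hne : ({n | ∃ f c, IsOptimalColoring G f ∧ IsPermutationOf c f ∧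
      colVillainy G c = n}).Nonempty := by
      by_contra h
      rw [Set.not_nonempty_iff_eq_empty] at h
      unfold villainy at hB
      rw [h] at hB
      simp at hB
    have hm := Nat.sSup_mem hne ⟨_, hbdd⟩
    change villainy G ∈ _ at hm
    rw [hB] at hm
    obtain ⟨f, c, hf, ⟨σ, rfl⟩, h2⟩ := hm
    have hnp : ¬ IsProperColoring G (f ∘ σ) := by
      intro hp
      have : colVillainy G (f ∘ σ) ≤ 0 := Nat.sInf_le ⟨f ∘ σ, hp, fun _ => rfl, by
        simp [recolorCount]⟩
      omega
    refine ⟨f, hf, ?_, ?_⟩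
    · intro hi
      apply hnp
      intro u v huv he
      exact huv.ne (σ.injective (hi he))
    · unfold IsProperColoring at hnp
      push Not at hnp
      obtain ⟨u, v, h, -⟩ := hnp
      exact ⟨u, v, h⟩

theorem chrom_le (G : SimpleGraph V) (f : V → ℕ) (hf : IsProperColoring G f) :
    chromNum G ≤ (univ.image f).card := by
  have hc : G.Colorable (univ.image f).card := by
    have c : G.Coloring (univ.image f) := SimpleGraph.Coloring.mk
      (fun v => ⟨f v, by simp⟩) (by intro u v h he; exact hf h (by simpa using he))
    simpa using c.colorable
  exact ENat.toNat_le_of_le_natCast hc.chromaticNumber_le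

theorem chrom_colorable (G : SimpleGraph V) : G.Colorable (chromNum G) :=
  SimpleGraph.colorable_chromaticNumber_of_fintype G

theorem opt_of_image (G : SimpleGraph V) (f g : V → ℕ) (hf : IsOptimalColoring G f)
    (hg : IsProperColoring G g) (hi : ∀ v, ∃ u, g v = f u) :
    IsOptimalColoring G g ∧ ∀ v, ∃ u, f v = g u := by
  have h1 : univ.image g ⊆ univ.image f := by
    intro k; simp only [Finset.mem_image, Finset.mem_univ, true_and]
    rintro ⟨v, rfl⟩; obtain ⟨u, hu⟩ := hi v; exact ⟨u, hu.symm⟩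
  have h2 := Finset.card_le_card h1
  have h3 := chrom_le G g hg
  have h4 := hf.2
  refine ⟨⟨hg, by omega⟩, fun v => ?_⟩
  have h5 := Finset.eq_of_subset_of_card_le h1 (by omega)
  have : f v ∈ univ.image g := by rw [h5]; simp
  simp only [Finset.mem_image, Finset.mem_univ, true_and] at this
  obtain ⟨u, hu⟩ := this; exact ⟨u, hu.symm⟩

theorem exists_perm {n : ℕ} (p q : Fin n → V) (hp : p.Injective) (hq : q.Injective) :
    ∃ σ : Equiv.Perm V, ∀ i, σ (q i) = p i := by
  have := Equiv.Perm.isMultiplyPretransitive V n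
  obtain ⟨σ, hσ⟩ := (MulAction.isMultiplyPretransitive_iff (G := Equiv.Perm V)).mp this
    (x := ⟨q, hq⟩) (y := ⟨p, hp⟩)
  refine ⟨σ, fun i => ?_⟩
  have := DFunLike.congr_fun hσ i
  simpa using this

theorem swap_use (G : SimpleGraph V) (hS : SwapProp G) (f : V → ℕ) (hf : IsOptimalColoring G f)
    {n : ℕ} (p q : Fin n → V) (hp : p.Injective) (hq : q.Injective) :
    ∃ c c' : V → ℕ, (∀ i, c (q i) = f (p i)) ∧ (∀ v, ∃ u, c v = f u) ∧ (∀ v, ∃ u, c' v = f u) ∧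
     (∀ u v, G.Adj u v → c' u ≠ c' v) ∧
     (c' = c ∨ ∃ x y, x ≠ y ∧ c' x = c y ∧ c' y = c x ∧
      ∀ z, z = x ∨ z = y ∨ c' z = c z) := by
  obtain ⟨σ, hσ⟩ := exists_perm p q hp hq
  obtain ⟨c', h1, h2⟩ := hS f hf σ
  refine ⟨f ∘ σ, c', fun i => by simp [hσ], fun v => ⟨σ v, rfl⟩, ?_, h1, h2⟩
  intro v
  rcases h2 with rfl | ⟨x, y, _, h3, h4, h5⟩
  · exact ⟨_, rfl⟩
  · by_cases hx : v = x
    · exact ⟨_, hx ▸ h3⟩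
    · by_cases hy : v = y
      · exact ⟨_, hy ▸ h4⟩
      · exact ⟨_, ((h5 v).resolve_left hx).resolve_left hy⟩

theorem inj_vec {n : ℕ} (p : Fin n → V) (h : (List.ofFn p).Nodup) : p.Injective :=
  List.nodup_ofFn.mp h

theorem no_two_matching (G : SimpleGraph V) (hS : SwapProp G) (f : V → ℕ)
    (hf : IsOptimalColoring G f) (p1 p2 p3 p4 a b c d : V) (hp : [p1, p2, p3, p4].Nodup)
    (h2 : f p2 = f p1) (h3 : f p3 = f p1) (h4 : f p4 = f p1)
    (hq : [a, b, c, d].Nodup) (hab : G.Adj a b) (hcd : G.Adj c d) : False := by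
  obtain ⟨k, k', e1, -, -, e2, e3⟩ := swap_use G hS f hf ![p1, p2, p3, p4] ![a, b, c, d]
    (inj_vec _ (by simpa using hp)) (inj_vec _ (by simpa using hq))
  simp [Fin.forall_fin_succ] at e1
  have n1 := e2 _ _ hab
  have n2 := e2 _ _ hcd
  simp at hq
  clear hp e2 hS hf
  rcases e3 with rfl | ⟨x, y, hxy, e4, e5, e6⟩
  · grind
  · have := e6 a
    have := e6 b
    have := e6 c
    have := e6 d
    clear e6
    grind

theorem no_triangle (G : SimpleGraph V) (hS : SwapProp G) (f : V → ℕ)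
    (hf : IsOptimalColoring G f) (p1 p2 p3 a b c : V) (hp : [p1, p2, p3].Nodup)
    (h2 : f p2 = f p1) (h3 : f p3 = f p1)
    (hab : G.Adj a b) (hbc : G.Adj b c) (hca : G.Adj c a) : False := by
  have hq : [a, b, c].Nodup := by
    have := hab.ne; have := hbc.ne; have := hca.ne; simp; grind
  obtain ⟨k, k', e1, -, -, e2, e3⟩ := swap_use G hS f hf ![p1, p2, p3] ![a, b, c]
    (inj_vec _ (by simpa using hp)) (inj_vec _ (by simpa using hq))
  simp [Fin.forall_fin_succ] at e1
  have n1 := e2 _ _ hab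
  have n2 := e2 _ _ hbc
  have n3 := e2 _ _ hca
  simp at hq
  clear hp e2 hS hf
  rcases e3 with rfl | ⟨x, y, hxy, e4, e5, e6⟩
  · grind
  · have := e6 a
    have := e6 b
    have := e6 c
    clear e6
    grind

theorem no_three_matching (G : SimpleGraph V) (hS : SwapProp G) (f : V → ℕ)
    (hf : IsOptimalColoring G f) (p1 p2 p3 p4 p5 p6 a b c d e g : V)
    (hp : [p1, p2, p3, p4, p5, p6].Nodup)
    (h2 : f p1 = f p2) (h3 : f p3 = f p4) (h4 : f p5 = f p6)
    (hq : [a, b, c, d, e, g].Nodup) (hab : G.Adj a b) (hcd : G.Adj c d) (heg : G.Adj e g) :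
    False := by
  obtain ⟨k, k', e1, -, -, e2, e3⟩ := swap_use G hS f hf ![p1, p2, p3, p4, p5, p6]
    ![a, b, c, d, e, g]
    (inj_vec _ (by simpa using hp)) (inj_vec _ (by simpa using hq))
  simp [Fin.forall_fin_succ] at e1
  have n1 := e2 _ _ hab
  have n2 := e2 _ _ hcd
  have n3 := e2 _ _ heg
  simp at hq
  clear hS hf
  rcases e3 with rfl | ⟨x, y, hxy, e4, e5, e6⟩
  · grind
  · have m1 : (a = x ∨ a = y) ∨ (b = x ∨ b = y) := by
      grind
    have m2 : (c = x ∨ c = y) ∨ (d = x ∨ d = y) := by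
      grind
    have m3 : (e = x ∨ e = y) ∨ (g = x ∨ g = y) := by
      grind
    clear e1 e2 e4 e5 e6 hp h2 h3 h4 n1 n2 n3
    grind

theorem two_edges (G : SimpleGraph V) (hS : SwapProp G) (f : V → ℕ)
    (hf : IsOptimalColoring G f) (p1 p2 p3 p4 a b c d : V) (hp : [p1, p2, p3, p4].Nodup)
    (h2 : f p1 = f p2) (h3 : f p3 = f p4)
    (hq : [a, b, c, d].Nodup) (hab : G.Adj a b) (hcd : G.Adj c d) :
    (¬ G.Adj a c ∧ ¬ G.Adj b d) ∨ (¬ G.Adj a d ∧ ¬ G.Adj b c) := by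
  obtain ⟨k, k', e1, -, -, e2, e3⟩ := swap_use G hS f hf ![p1, p2, p3, p4] ![a, b, c, d]
    (inj_vec _ (by simpa using hp)) (inj_vec _ (by simpa using hq))
  simp [Fin.forall_fin_succ] at e1
  have n1 := e2 _ _ hab
  have n2 := e2 _ _ hcd
  have n3 := e2 a c
  have n4 := e2 b d
  have n5 := e2 a d
  have n6 := e2 b c
  simp at hq
  clear hS hf
  rcases e3 with rfl | ⟨x, y, hxy, e4, e5, e6⟩
  · grind
  · have m1 : (a = x ∨ a = y) ∨ (b = x ∨ b = y) := by
      grind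
    have m2 : (c = x ∨ c = y) ∨ (d = x ∨ d = y) := by
      grind
    have ea := e6 a
    have eb := e6 b
    have ec := e6 c
    have ed := e6 d
    clear e2 e6
    grind

theorem no_five_cycle (G : SimpleGraph V) (hS : SwapProp G) (f : V → ℕ)
    (hf : IsOptimalColoring G f) (p1 p2 p3 p4 p5 a b c d e : V) (hp : [p1, p2, p3, p4, p5].Nodup)
    (h2 : f p1 = f p2) (h3 : f p1 = f p3) (h4 : f p4 = f p5)
    (hq : [a, b, c, d, e].Nodup) (hab : G.Adj a b) (hbc : G.Adj b c) (hcd : G.Adj c d)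
    (hde : G.Adj d e) (hea : G.Adj e a) : False := by
  obtain ⟨k, k', e1, -, -, e2, e3⟩ := swap_use G hS f hf ![p1, p2, p3, p4, p5] ![a, b, c, d, e]
    (inj_vec _ (by simpa using hp)) (inj_vec _ (by simpa using hq))
  simp [Fin.forall_fin_succ] at e1
  have n1 := e2 _ _ hab
  have n2 := e2 _ _ hbc
  have n3 := e2 _ _ hcd
  have n4 := e2 _ _ hde
  have n5 := e2 _ _ hea
  simp at hq
  clear hS hf
  rcases e3 with rfl | ⟨x, y, hxy, e4, e5, e6⟩
  · grind
  · have ea := e6 a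
    have eb := e6 b
    have ec := e6 c
    have ed := e6 d
    have ee := e6 e
    have m1 : b = x ∨ b = y := by
      grind
    have m2 : (d = x ∨ d = y) ∨ (e = x ∨ e = y) := by
      grind
    clear e2 e6
    grind

/-- order five: `a,c,e | b,d` with edges `ab, eb, cd` -/
theorem no_order_five (G : SimpleGraph V) (hS : SwapProp G) (f : V → ℕ)
    (hf : IsOptimalColoring G f) (a b c d e : V)
    (hq : [a, b, c, d, e].Nodup) (hall : ∀ v, v = a ∨ v = b ∨ v = c ∨ v = d ∨ v = e)
    (h1 : f c = f a) (h2 : f e = f a) (h3 : f d = f b) (h4 : f b ≠ f a)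
    (hab : G.Adj a b) (hbc : G.Adj e b) (hcd : G.Adj c d) : False := by
  obtain ⟨k, k', e1, -, hcol, e2, e3⟩ := swap_use G hS f hf ![a, c, e, b, d] ![b, c, d, a, e]
    (inj_vec _ (by simp at hq ⊢; grind)) (inj_vec _ (by simp at hq ⊢; grind))
  simp [Fin.forall_fin_succ] at e1
  have n1 := e2 _ _ hab
  have n2 := e2 _ _ hbc
  have n3 := e2 _ _ hcd
  have hcol' : ∀ v, k' v = f a ∨ k' v = f b := by
    intro v
    obtain ⟨u, hu⟩ := hcol v
    rw [hu]
    rcases hall u with rfl | rfl | rfl | rfl | rfl <;> simp [h1, h2, h3]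
  have ca := hcol' a
  have cb := hcol' b
  have cc := hcol' c
  have cd := hcol' d
  have ce := hcol' e
  simp at hq
  clear hS hf
  rcases e3 with rfl | ⟨x, y, hxy, e4, e5, e6⟩
  · grind
  · have ea := e6 a
    have eb := e6 b
    have ec := e6 c
    have ed := e6 d
    have ee := e6 e
    clear e2 e6 hcol hcol'
    have hx := hall x
    have hy := hall y
    clear hall
    grind

/-- star with at least three leaves and an isolated vertex `i` -/
theorem no_star_iso (G : SimpleGraph V) (hS : SwapProp G) (f : V → ℕ)
    (hf : IsOptimalColoring G f) (z i l1 l2 l3 : V) (hq : [z, i, l1, l2, l3].Nodup)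
    (h1 : f i = f z) (h2 : ∀ v, v ≠ z → v ≠ i → f v = f l1) (h3 : f l1 ≠ f z)
    (e1 : G.Adj z l1) (e2 : G.Adj z l2) (e3 : G.Adj z l3) : False := by
  have h4 := h2 l2 (by simp at hq; grind) (by simp at hq; grind)
  have h5 := h2 l3 (by simp at hq; grind) (by simp at hq; grind)
  obtain ⟨σ, hσ⟩ := exists_perm ![z, i] ![l1, l2] (inj_vec _ (by simp at hq ⊢; grind))
    (inj_vec _ (by simp at hq ⊢; grind))
  obtain ⟨c', hp, hc⟩ := hS f hf σ
  simp [Fin.forall_fin_succ] at hσ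
  have hoth : ∀ v, v = l1 ∨ v = l2 ∨ f (σ v) = f l1 := by
    intro v
    by_cases hv1 : v = l1
    · exact Or.inl hv1
    by_cases hv2 : v = l2
    · exact Or.inr (Or.inl hv2)
    right; right
    apply h2
    · rw [← hσ.1]; exact fun h => hv1 (σ.injective h)
    · rw [← hσ.2]; exact fun h => hv2 (σ.injective h)
  have n1 := hp e1
  have n2 := hp e2
  have n3 := hp e3
  have o1 := hoth z
  have o3 := hoth l3
  have hs1 : f (σ l1) = f z := by rw [hσ.1]
  have hs2 : f (σ l2) = f z := by rw [hσ.2, h1]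
  simp at hq
  clear hS hf
  rcases hc with rfl | ⟨x, y, hxy, e4, e5, e6⟩
  · simp only [Function.comp] at *
    grind
  · have ez := e6 z
    have e71 := e6 l1
    have e72 := e6 l2
    have e73 := e6 l3
    have ox := hoth x
    have oy := hoth y
    clear e6 hoth h2
    rcases ez with h | h | h <;> rcases e73 with h' | h' | h' <;> grind

theorem iso_of_map {W : Type} (G : SimpleGraph V) (H : SimpleGraph W) (φ : W → V)
    (hi : φ.Injective) (hs : φ.Surjective) (h : ∀ w w', G.Adj (φ w) (φ w') ↔ H.Adj w w') :
    Nonempty (G ≃g H) :=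
  ⟨(RelIso.mk (Equiv.ofBijective φ ⟨hi, hs⟩) (by intro a b; exact h a b) : H ≃g G).symm⟩

theorem four_iso (G : SimpleGraph V) (a b c d : V) (hq : [a, b, c, d].Nodup)
    (hall : ∀ v, v = a ∨ v = b ∨ v = c ∨ v = d)
    (hab : G.Adj a b) (hcd : G.Adj c d) (hac : ¬ G.Adj a c) (hbd : ¬ G.Adj b d) :
    Nonempty (G ≃g SimpleGraph.pathGraph 4) ∨ Nonempty (G ≃g SimpleGraph.cycleGraph 4) ∨
    Nonempty (G ≃g (⊤ : SimpleGraph (Fin 2)) ⊕g (⊤ : SimpleGraph (Fin 2))) := by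
  have hc := G.adj_comm
  have hl := fun v => G.loopless.irrefl v
  have inj4 : ∀ a b c d : V, [a, b, c, d].Nodup → (![a, b, c, d] : Fin 4 → V).Injective :=
    fun a b c d h => inj_vec _ (by simpa using h)
  by_cases h1 : G.Adj a d <;> by_cases h2 : G.Adj b c
  · right; left
    refine iso_of_map G _ ![a, b, c, d] (inj4 _ _ _ _ hq) ?_ ?_
    · intro v; have := hall v; simp [Fin.exists_fin_succ]; grind
    · simp [Fin.forall_fin_succ, SimpleGraph.cycleGraph_adj']; grind
  · left
    refine iso_of_map G _ ![b, a, d, c] (inj4 _ _ _ _ (by simp at hq ⊢; grind)) ?_ ?_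
    · intro v; have := hall v; simp [Fin.exists_fin_succ]; grind
    · simp [Fin.forall_fin_succ, SimpleGraph.pathGraph_adj]; grind
  · left
    refine iso_of_map G _ ![a, b, c, d] (inj4 _ _ _ _ hq) ?_ ?_
    · intro v; have := hall v; simp [Fin.exists_fin_succ]; grind
    · simp [Fin.forall_fin_succ, SimpleGraph.pathGraph_adj]; grind
  · right; right
    refine iso_of_map G _ (Sum.elim ![a, b] ![c, d]) ?_ ?_ ?_
    · simp at hq; intro x y; rcases x with x | x <;> rcases y with y | y <;> fin_cases x <;>
        fin_cases y <;> simp <;> grind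
    · intro v; have := hall v; simp [Fin.exists_fin_succ]; grind
    · simp [Fin.forall_fin_succ]; grind

theorem four_iso_one (G : SimpleGraph V) (a b c d e : V) (hq : [a, b, c, d, e].Nodup)
    (hall : ∀ v, v = a ∨ v = b ∨ v = c ∨ v = d ∨ v = e)
    (hab : G.Adj a b) (hcd : G.Adj c d) (hac : ¬ G.Adj a c) (hbd : ¬ G.Adj b d)
    (he : ∀ v, ¬ G.Adj e v) :
    Nonempty (G ≃g SimpleGraph.pathGraph 4 ⊕g (⊥ : SimpleGraph (Fin 1))) ∨
    Nonempty (G ≃g SimpleGraph.cycleGraph 4 ⊕g (⊥ : SimpleGraph (Fin 1))) ∨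
    Nonempty (G ≃g ((⊤ : SimpleGraph (Fin 2)) ⊕g (⊤ : SimpleGraph (Fin 2)))
      ⊕g (⊥ : SimpleGraph (Fin 1))) := by
  have hc := G.adj_comm
  have hl := fun v => G.loopless.irrefl v
  have inj4 : ∀ a b c d : V, [a, b, c, d, e].Nodup →
      (Sum.elim ![a, b, c, d] ![e] : Fin 4 ⊕ Fin 1 → V).Injective := by
    intro a b c d h
    simp at h
    refine Function.Injective.sumElim (inj_vec _ (by simp; grind)) (inj_vec _ (by simp)) ?_
    simp [Fin.forall_fin_succ]; grind
  by_cases h1 : G.Adj a d <;> by_cases h2 : G.Adj b c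
  · right; left
    refine iso_of_map G _ (Sum.elim ![a, b, c, d] ![e]) (inj4 _ _ _ _ hq) ?_ ?_
    · intro v; have := hall v; simp [Fin.exists_fin_succ]; grind
    · simp [Fin.forall_fin_succ, SimpleGraph.cycleGraph_adj']; grind
  · left
    refine iso_of_map G _ (Sum.elim ![b, a, d, c] ![e])
      (inj4 _ _ _ _ (by simp at hq ⊢; grind)) ?_ ?_
    · intro v; have := hall v; simp [Fin.exists_fin_succ]; grind
    · simp [Fin.forall_fin_succ, SimpleGraph.pathGraph_adj]; grind
  · left
    refine iso_of_map G _ (Sum.elim ![a, b, c, d] ![e]) (inj4 _ _ _ _ hq) ?_ ?_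
    · intro v; have := hall v; simp [Fin.exists_fin_succ]; grind
    · simp [Fin.forall_fin_succ, SimpleGraph.pathGraph_adj]; grind
  · right; right
    refine iso_of_map G _ (Sum.elim (Sum.elim ![a, b] ![c, d]) ![e]) ?_ ?_ ?_
    · simp at hq
      refine Function.Injective.sumElim (Function.Injective.sumElim (inj_vec _ (by simp; grind))
        (inj_vec _ (by simp; grind)) ?_) (inj_vec _ (by simp)) ?_ <;>
      · simp [Fin.forall_fin_succ]; grind
    · intro v; have := hall v; simp [Fin.exists_fin_succ]; grind
    · simp [Fin.forall_fin_succ]; grind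

theorem four_iso_two (G : SimpleGraph V) (a b c d e h : V) (hq : [a, b, c, d, e, h].Nodup)
    (hall : ∀ v, v = a ∨ v = b ∨ v = c ∨ v = d ∨ v = e ∨ v = h)
    (hab : G.Adj a b) (hcd : G.Adj c d) (heh : G.Adj e h) (hac : ¬ G.Adj a c) (hbd : ¬ G.Adj b d)
    (he : ∀ v, G.Adj e v → v = h) (hh : ∀ v, G.Adj h v → v = e) :
    Nonempty (G ≃g SimpleGraph.pathGraph 4 ⊕g (⊤ : SimpleGraph (Fin 2))) ∨
    Nonempty (G ≃g SimpleGraph.cycleGraph 4 ⊕g (⊤ : SimpleGraph (Fin 2))) ∨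
    Nonempty (G ≃g ((⊤ : SimpleGraph (Fin 2)) ⊕g (⊤ : SimpleGraph (Fin 2)))
      ⊕g (⊤ : SimpleGraph (Fin 2))) := by
  have hc := G.adj_comm
  have hl := fun v => G.loopless.irrefl v
  have inj4 : ∀ a b c d : V, [a, b, c, d, e, h].Nodup →
      (Sum.elim ![a, b, c, d] ![e, h] : Fin 4 ⊕ Fin 2 → V).Injective := by
    intro a b c d h
    simp at h
    refine Function.Injective.sumElim (inj_vec _ (by simp; grind)) (inj_vec _ (by simp; grind)) ?_
    simp [Fin.forall_fin_succ]; grind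
  have hq' := hq
  simp at hq'
  have e1 : ¬ G.Adj e a ∧ ¬ G.Adj e b ∧ ¬ G.Adj e c ∧ ¬ G.Adj e d := by grind
  have e2 : ¬ G.Adj h a ∧ ¬ G.Adj h b ∧ ¬ G.Adj h c ∧ ¬ G.Adj h d := by grind
  have e3 : ¬ G.Adj a e ∧ ¬ G.Adj b e ∧ ¬ G.Adj c e ∧ ¬ G.Adj d e := by grind
  have e4 : ¬ G.Adj a h ∧ ¬ G.Adj b h ∧ ¬ G.Adj c h ∧ ¬ G.Adj d h := by grind
  have s1 := hab.symm
  have s2 := hcd.symm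
  have s3 := heh.symm
  have s4 := mt G.adj_symm hac
  have s5 := mt G.adj_symm hbd
  by_cases h1 : G.Adj a d <;> by_cases h2 : G.Adj b c
  · right; left
    refine iso_of_map G _ (Sum.elim ![a, b, c, d] ![e, h]) (inj4 _ _ _ _ hq) ?_ ?_
    · intro v; have := hall v; simp [Fin.exists_fin_succ]; grind
    · have := h1.symm
      have := h2.symm
      simp [Fin.forall_fin_succ, SimpleGraph.cycleGraph_adj', *]; decide
  · left
    refine iso_of_map G _ (Sum.elim ![b, a, d, c] ![e, h])
      (inj4 _ _ _ _ (by simp; grind)) ?_ ?_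
    · intro v; have := hall v; simp [Fin.exists_fin_succ]; grind
    · have := h1.symm
      have := mt G.adj_symm h2
      simp [Fin.forall_fin_succ, SimpleGraph.pathGraph_adj, *]
  · left
    refine iso_of_map G _ (Sum.elim ![a, b, c, d] ![e, h]) (inj4 _ _ _ _ hq) ?_ ?_
    · intro v; have := hall v; simp [Fin.exists_fin_succ]; grind
    · have := h2.symm
      have := mt G.adj_symm h1
      simp [Fin.forall_fin_succ, SimpleGraph.pathGraph_adj, *]
  · right; right
    refine iso_of_map G _ (Sum.elim (Sum.elim ![a, b] ![c, d]) ![e, h]) ?_ ?_ ?_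
    · refine Function.Injective.sumElim (Function.Injective.sumElim (inj_vec _ (by simp; grind))
        (inj_vec _ (by simp; grind)) ?_) (inj_vec _ (by simp; grind)) ?_ <;>
      · simp [Fin.forall_fin_succ]; grind
    · intro v; have := hall v; simp [Fin.exists_fin_succ]; grind
    · have := mt G.adj_symm h2
      have := mt G.adj_symm h1
      simp [Fin.forall_fin_succ, *]

theorem five_cycle_iso (G : SimpleGraph V) (a b c d e : V) (hq : [a, b, c, d, e].Nodup)
    (hall : ∀ v, v = a ∨ v = b ∨ v = c ∨ v = d ∨ v = e)
    (hab : G.Adj a b) (hbc : G.Adj b c) (hcd : G.Adj c d) (hde : G.Adj d e) (hea : G.Adj e a)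
    (ht : ∀ x y z, G.Adj x y → G.Adj y z → ¬ G.Adj z x) :
    Nonempty (G ≃g SimpleGraph.cycleGraph 5) := by
  have n1 := ht _ _ _ hab hbc
  have n2 := ht _ _ _ hbc hcd
  have n3 := ht _ _ _ hcd hde
  have n4 := ht _ _ _ hde hea
  have n5 := ht _ _ _ hea hab
  have m1 := mt G.adj_symm n1
  have m2 := mt G.adj_symm n2
  have m3 := mt G.adj_symm n3
  have m4 := mt G.adj_symm n4
  have m5 := mt G.adj_symm n5
  have := hab.symm
  have := hbc.symm
  have := hcd.symm
  have := hde.symm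
  have := hea.symm
  refine iso_of_map G _ ![a, b, c, d, e] (inj_vec _ (by simpa using hq)) ?_ ?_
  · intro v; have := hall v; simp [Fin.exists_fin_succ]; grind
  · simp [Fin.forall_fin_succ, SimpleGraph.cycleGraph_adj', *]; decide

theorem tri_edge_iso (G : SimpleGraph V) (a b c d e : V) (hq : [a, b, c, d, e].Nodup)
    (hall : ∀ v, v = a ∨ v = b ∨ v = c ∨ v = d ∨ v = e)
    (hab : G.Adj a b) (hbc : G.Adj b c) (hca : G.Adj c a) (hde : G.Adj d e)
    (hd : ∀ v, G.Adj d v → v = e) (he : ∀ v, G.Adj e v → v = d) :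
    Nonempty (G ≃g (⊤ : SimpleGraph (Fin 3)) ⊕g (⊤ : SimpleGraph (Fin 2))) := by
  have hc := G.adj_comm
  have hl := fun v => G.loopless.irrefl v
  simp at hq
  refine iso_of_map G _ (Sum.elim ![a, b, c] ![d, e]) ?_ ?_ ?_
  · refine Function.Injective.sumElim (inj_vec _ (by simp; grind)) (inj_vec _ (by simp; grind)) ?_
    simp [Fin.forall_fin_succ]; grind
  · intro v; have := hall v; simp [Fin.exists_fin_succ]; grind
  · simp [Fin.forall_fin_succ]; grind

theorem tri_tri_iso (G : SimpleGraph V) (a b c d e h : V) (hq : [a, b, c, d, e, h].Nodup)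
    (hall : ∀ v, v = a ∨ v = b ∨ v = c ∨ v = d ∨ v = e ∨ v = h)
    (hab : G.Adj a b) (hbc : G.Adj b c) (hca : G.Adj c a) (hde : G.Adj d e) (heh : G.Adj e h)
    (hhd : G.Adj h d)
    (ha : ∀ v, G.Adj a v → v = b ∨ v = c) (hb : ∀ v, G.Adj b v → v = a ∨ v = c)
    (hcc : ∀ v, G.Adj c v → v = a ∨ v = b) :
    Nonempty (G ≃g (⊤ : SimpleGraph (Fin 3)) ⊕g (⊤ : SimpleGraph (Fin 3))) := by
  simp at hq
  have e1 : ¬ G.Adj a d ∧ ¬ G.Adj a e ∧ ¬ G.Adj a h := by grind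
  have e2 : ¬ G.Adj b d ∧ ¬ G.Adj b e ∧ ¬ G.Adj b h := by grind
  have e3 : ¬ G.Adj c d ∧ ¬ G.Adj c e ∧ ¬ G.Adj c h := by grind
  have hc := G.adj_comm
  have e4 : ¬ G.Adj d a ∧ ¬ G.Adj e a ∧ ¬ G.Adj h a := by grind
  have e5 : ¬ G.Adj d b ∧ ¬ G.Adj e b ∧ ¬ G.Adj h b := by grind
  have e6 : ¬ G.Adj d c ∧ ¬ G.Adj e c ∧ ¬ G.Adj h c := by grind
  clear hc
  have := hab.symm
  have := hbc.symm
  have := hca.symm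
  have := hde.symm
  have := heh.symm
  have := hhd.symm
  refine iso_of_map G _ (Sum.elim ![a, b, c] ![d, e, h]) ?_ ?_ ?_
  · refine Function.Injective.sumElim (inj_vec _ (by simp; grind)) (inj_vec _ (by simp; grind)) ?_
    simp [Fin.forall_fin_succ]; grind
  · intro v; have := hall v; simp [Fin.exists_fin_succ]; grind
  · simp [Fin.forall_fin_succ, *]

theorem opt_of_le (G : SimpleGraph V) (g : V → ℕ) (hg : IsProperColoring G g)
    (h : (univ.image g).card ≤ chromNum G) : IsOptimalColoring G g :=
  ⟨hg, le_antisymm h (chrom_le G g hg)⟩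

theorem chrom_two_le (G : SimpleGraph V) (u v : V) (h : G.Adj u v) : 2 ≤ chromNum G := by
  by_contra hlt
  have hc : G.Colorable 1 := (chrom_colorable G).mono (by omega)
  obtain ⟨c⟩ := hc
  exact c.valid h (Subsingleton.elim _ _)

theorem opt_of_two (G : SimpleGraph V) (g : V → ℕ) (hg : IsProperColoring G g)
    (hv : ∀ v, g v = 0 ∨ g v = 1) (u v : V) (h : G.Adj u v) : IsOptimalColoring G g := by
  apply opt_of_le G g hg
  refine le_trans (Finset.card_le_card (t := {0, 1}) ?_) (le_trans ?_ (chrom_two_le G u v h))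
  · intro x
    simp
    rintro v rfl
    exact hv v
  · simp

theorem iso_add_isolated {k : ℕ} (G : SimpleGraph V) (H : SimpleGraph (Fin k)) (φ : Fin k → V)
    (hi : φ.Injective) (h : ∀ i j, G.Adj (φ i) (φ j) ↔ H.Adj i j)
    (hiso : ∀ v, v ∉ Set.range φ → ∀ u, ¬ G.Adj v u) (w : V) (hw : w ∉ Set.range φ) :
    ∃ r : ℕ, 1 ≤ r ∧ Nonempty (G ≃g H ⊕g (⊥ : SimpleGraph (Fin r))) := by
  classical
  let e := (Fintype.equivFin {v // v ∉ Set.range φ}).symm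
  refine ⟨_, Fintype.card_pos_iff.2 ⟨⟨w, hw⟩⟩, iso_of_map G _ (Sum.elim φ (fun i => (e i).1)) ?_ ?_ ?_⟩
  · refine hi.sumElim (Subtype.val_injective.comp e.injective) ?_
    intro a b hab
    exact (e b).2 ⟨a, hab⟩
  · intro v
    by_cases hv : v ∈ Set.range φ
    · obtain ⟨i, hi⟩ := hv
      exact ⟨Sum.inl i, hi⟩
    · exact ⟨Sum.inr (e.symm ⟨v, hv⟩), by simp⟩
  · rintro (i | i) (j | j)
    · simpa using h i j
    · simpa using fun hh => hiso _ (e j).2 _ hh.symm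
    · simpa using fun hh => hiso _ (e i).2 _ hh
    · simpa using fun hh => hiso _ (e i).2 _ hh

theorem iso_star (G : SimpleGraph V) (z : V) (h : ∀ u v, G.Adj u v → u = z ∨ v = z)
    (h' : ∀ v, v ≠ z → G.Adj z v) (a b : V) (hab : a ≠ b) (ha : a ≠ z) (hb : b ≠ z) :
    ∃ t : ℕ, 2 ≤ t ∧ Nonempty (G ≃g starGraph t) := by
  classical
  let e := (Fintype.equivFin {v // v ≠ z}).symm
  refine ⟨Fintype.card {v // v ≠ z}, ?_, iso_of_map G _ (Fin.cons z (fun i => (e i).1)) ?_ ?_ ?_⟩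
  · exact Fintype.one_lt_card_iff.2 ⟨⟨a, ha⟩, ⟨b, hb⟩, by simpa using hab⟩
  · refine Fin.cons_injective_iff.2 ⟨?_, Subtype.val_injective.comp e.injective⟩
    rintro ⟨i, hi⟩
    exact (e i).2 hi
  · intro v
    by_cases hv : v = z
    · exact ⟨0, by simp [hv]⟩
    · exact ⟨Fin.succ (e.symm ⟨v, hv⟩), by simp⟩
  · intro i j
    refine Fin.cases ?_ ?_ i <;> refine Fin.cases ?_ ?_ j <;> simp [starGraph]
    · intro i
      exact ⟨fun _ => (Fin.succ_ne_zero _).symm, fun _ => h' _ (e i).2⟩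
    · intro i
      exact (h' _ (e i).2).symm
    · intro i j hh
      rcases h _ _ hh with h | h
      · exact (e j).2 h
      · exact (e i).2 h

theorem star_case (G : SimpleGraph V) (hS : SwapProp G) (z : V)
    (h : ∀ u v, G.Adj u v → u = z ∨ v = z) (u v : V) (huv : G.Adj u v)
    (w : V) (hw1 : w ≠ u) (hw2 : w ≠ v) :
    (∃ t : ℕ, 2 ≤ t ∧ Nonempty (G ≃g starGraph t)) ∨
    (∃ r : ℕ, 1 ≤ r ∧
      Nonempty (G ≃g SimpleGraph.pathGraph 3 ⊕g (⊥ : SimpleGraph (Fin r)))) ∨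
    (∃ r : ℕ, 1 ≤ r ∧
      Nonempty (G ≃g (⊤ : SimpleGraph (Fin 2)) ⊕g (⊥ : SimpleGraph (Fin r)))) := by
  classical
  have hc := G.adj_comm
  have hl := fun v => G.loopless.irrefl v
  by_cases h0 : ∀ v, v ≠ z → G.Adj z v
  · left
    rcases h u v huv with rfl | rfl
    · exact iso_star G u h h0 v w hw2.symm huv.ne' hw1
    · exact iso_star G v h h0 u w hw1.symm huv.ne hw2
  push Not at h0
  obtain ⟨i, hiz, hi⟩ := h0
  right
  obtain ⟨l, hzl⟩ : ∃ l, G.Adj z l := by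
    rcases h u v huv with rfl | rfl
    · exact ⟨_, huv⟩
    · exact ⟨_, huv.symm⟩
  by_cases h1 : ∀ v, G.Adj z v → v = l
  · right
    refine iso_add_isolated G _ ![z, l] (inj_vec _ (by simpa using hzl.ne)) ?_ ?_ i ?_
    · simp [Fin.forall_fin_succ]; grind
    · simp [Fin.forall_fin_succ]; grind
    · simp; grind
  push Not at h1
  obtain ⟨l2, hzl2, hl2⟩ := h1
  by_cases h2 : ∀ v, G.Adj z v → v = l ∨ v = l2
  · left
    have := hzl.ne
    have := hzl2.ne
    refine iso_add_isolated G _ ![l, z, l2] (inj_vec _ (by simp; grind)) ?_ ?_ i ?_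
    · simp [Fin.forall_fin_succ, SimpleGraph.pathGraph_adj]; grind
    · simp [Fin.forall_fin_succ]; grind
    · simp; grind
  push Not at h2
  obtain ⟨l3, hzl3, hl3⟩ := h2
  exfalso
  let g : V → ℕ := fun v => if v = z ∨ v = i then 0 else 1
  have hg : IsOptimalColoring G g := by
    refine opt_of_two G g ?_ ?_ u v huv
    · intro u v huv
      have := h u v huv
      have := hl u
      simp only [g]
      grind
    · intro v
      simp only [g]
      grind
  have := hzl.ne
  have := hzl2.ne
  have := hzl3.ne
  refine no_star_iso G hS g hg z i l l2 l3 ?_ ?_ ?_ ?_ hzl hzl2 hzl3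
  · simp; grind
  · simp [g]
  · intro v; simp only [g]; grind
  · simp only [g]; grind

/-- No optimal coloring has a color class with four vertices. -/
def NoFour (G : SimpleGraph V) : Prop :=
  ∀ g : V → ℕ, IsOptimalColoring G g → ∀ p1 p2 p3 p4 : V, [p1, p2, p3, p4].Nodup →
    g p2 = g p1 → g p3 = g p1 → g p4 = g p1 → False

theorem star_or (G : SimpleGraph V) (u v : V) (huv : G.Adj u v) :
    (∃ a b c, G.Adj a b ∧ G.Adj b c ∧ G.Adj c a) ∨
    (∃ a b c d, [a, b, c, d].Nodup ∧ G.Adj a b ∧ G.Adj c d) ∨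
    (∃ z, ∀ u v, G.Adj u v → u = z ∨ v = z) := by
  by_contra hcon
  push Not at hcon
  obtain ⟨ht, hm, hs⟩ := hcon
  have hm' : ∀ a b c d, G.Adj a b → G.Adj c d → a = c ∨ a = d ∨ b = c ∨ b = d := by
    intro a b c d hab hcd
    by_contra hne
    have := hab.ne
    have := hcd.ne
    exact hm a b c d (by simp; grind) hab hcd
  obtain ⟨x, y, hxy, hx, hy⟩ := hs u
  obtain ⟨p, q, hpq, hp, hq⟩ := hs v
  have hc := G.adj_comm
  have m1 := hm' _ _ _ _ huv hxy
  have m2 := hm' _ _ _ _ huv hpq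
  have m3 := hm' _ _ _ _ hxy hpq
  have t1 := ht u v y huv
  have t2 := ht u v x huv
  grind

theorem noFour_of (G : SimpleGraph V) (hS : SwapProp G)
    (h : (∃ a b c, G.Adj a b ∧ G.Adj b c ∧ G.Adj c a) ∨
      (∃ a b c d, [a, b, c, d].Nodup ∧ G.Adj a b ∧ G.Adj c d)) : NoFour G := by
  intro g hg p1 p2 p3 p4 hp h2 h3 h4
  rcases h with ⟨a, b, c, hab, hbc, hca⟩ | ⟨a, b, c, d, hq, hab, hcd⟩
  · exact no_triangle G hS g hg p1 p2 p3 a b c (by simp at hp ⊢; grind) h2 h3 hab hbc hca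
  · exact no_two_matching G hS g hg p1 p2 p3 p4 a b c d hp h2 h3 h4 hq hab hcd

theorem flip_contra (G : SimpleGraph V) (H4 : NoFour G) (g : V → ℕ) (hg : IsOptimalColoring G g)
    (x y : V) (hxy : g x ≠ g y) (hv : ∀ v, g v = g x ∨ g v = g y)
    (S : V → Prop) (hS : ∀ u v, G.Adj u v → (S u ↔ S v))
    (p1 p2 p3 p4 : V) (hp : [p1, p2, p3, p4].Nodup)
    (h1 : (S p1 ∧ g p1 = g y) ∨ (¬ S p1 ∧ g p1 = g x))
    (h2 : (S p2 ∧ g p2 = g y) ∨ (¬ S p2 ∧ g p2 = g x))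
    (h3 : (S p3 ∧ g p3 = g y) ∨ (¬ S p3 ∧ g p3 = g x))
    (h4 : (S p4 ∧ g p4 = g y) ∨ (¬ S p4 ∧ g p4 = g x)) : False := by
  classical
  let f : V → ℕ := fun v => if S v then (if g v = g x then g y else g x) else g v
  have hf : IsOptimalColoring G f := by
    refine (opt_of_image G g f hg ?_ ?_).1
    · intro u v huv
      have := hg.1 huv
      have := hS u v huv
      have := hv u
      have := hv v
      simp only [f]
      grind
    · intro v
      simp only [f]
      split_ifs
      exacts [⟨y, rfl⟩, ⟨x, rfl⟩, ⟨v, rfl⟩]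
  have k : ∀ p, (S p ∧ g p = g y) ∨ (¬ S p ∧ g p = g x) → f p = g x := by
    intro p hp
    simp only [f]
    grind
  exact H4 f hf p1 p2 p3 p4 hp (by rw [k _ h2, k _ h1]) (by rw [k _ h3, k _ h1])
    (by rw [k _ h4, k _ h1])

theorem bip_six (G : SimpleGraph V) (H4 : NoFour G) (g : V → ℕ)
    (hg : IsOptimalColoring G g) (a b c d e h : V) (hq : [a, b, c, d, e, h].Nodup)
    (hc : g c = g a) (he : g e = g a) (hd : g d = g b) (hh : g h = g b) (hne : g b ≠ g a)
    (hall : ∀ v, v = a ∨ v = b ∨ v = c ∨ v = d ∨ v = e ∨ v = h)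
    (hab : G.Adj a b) (hcd : G.Adj c d) :
    (Fintype.card V = 6 ∧ G.Connected ∧ ∃ X : Finset V, X.card = 3 ∧
      ∀ ⦃u v⦄, G.Adj u v → (u ∈ X ↔ v ∉ X)) ∨
    Nonempty (G ≃g SimpleGraph.pathGraph 4 ⊕g (⊤ : SimpleGraph (Fin 2))) ∨
    Nonempty (G ≃g SimpleGraph.cycleGraph 4 ⊕g (⊤ : SimpleGraph (Fin 2))) ∨
    Nonempty (G ≃g ((⊤ : SimpleGraph (Fin 2)) ⊕g (⊤ : SimpleGraph (Fin 2)))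
      ⊕g (⊤ : SimpleGraph (Fin 2))) := by
  have hq' := hq
  simp at hq'
  have hv : ∀ v, g v = g a ∨ g v = g b := by
    intro v; rcases hall v with rfl | rfl | rfl | rfl | rfl | rfl <;> simp [*]
  have hv' : ∀ v, g v = g b ∨ g v = g a := fun v => (hv v).symm
  have nadj : ∀ u v, g u = g v → ¬ G.Adj u v := fun u v h1 h2 => hg.1 h2 h1
  by_cases hcon : ∀ v, G.Reachable a v
  · left
    refine ⟨?_, (SimpleGraph.connected_iff_exists_forall_reachable G).2 ⟨a, hcon⟩, {a, c, e}, ?_, ?_⟩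
    · have : (univ : Finset V) = {a, b, c, d, e, h} := by
        ext v; have := hall v; simp; grind
      rw [← Finset.card_univ, this]
      simp [Finset.card_insert_of_notMem, hq']
    · simp [Finset.card_insert_of_notMem, hq']
    · intro u v huv
      have := hg.1 huv
      have := hall u
      have := hall v
      simp
      grind
  right
  set S : V → Prop := fun v => G.Reachable a v with hSdef
  have hScl : ∀ u v, G.Adj u v → (S u ↔ S v) := by
    intro u v huv
    exact ⟨fun h => h.trans huv.reachable, fun h => h.trans huv.symm.reachable⟩
  have Sa : S a := SimpleGraph.Reachable.refl a
  have hcon' : ¬ ∀ v, S v := hcon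
  clear hcon
  clear_value S
  have Sb : S b := (hScl _ _ hab).1 Sa
  have hScd := hScl _ _ hcd
  have nis_e : ∃ v, G.Adj e v := by
    by_contra hn
    push Not at hn
    refine flip_contra G H4 g hg b a hne hv' (fun v => v = e) ?_ b d h e ?_ ?_ ?_ ?_ ?_
    · intro u v huv
      have := hn u
      have := hn v
      have := huv.symm
      grind
    · simp; grind
    all_goals grind
  have nis_h : ∃ v, G.Adj h v := by
    by_contra hn
    push Not at hn
    refine flip_contra G H4 g hg a b hne.symm hv (fun v => v = h) ?_ a c e h ?_ ?_ ?_ ?_ ?_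
    · intro u v huv
      have := hn u
      have := hn v
      have := huv.symm
      grind
    · simp; grind
    all_goals grind
  have nac := nadj a c hc.symm
  have nae := nadj a e he.symm
  have nce := nadj c e (by rw [hc, he])
  have nbd := nadj b d hd.symm
  have nbh := nadj b h hh.symm
  have ndh := nadj d h (by rw [hd, hh])
  have hcomm := G.adj_comm
  obtain ⟨e', he'⟩ := nis_e
  obtain ⟨h', hh'⟩ := nis_h
  have cross : ∀ u v, S u → ¬ S v → ¬ G.Adj u v := fun u v h1 h2 h3 => h2 ((hScl _ _ h3).1 h1)
  have cross' : ∀ u v, ¬ S u → S v → ¬ G.Adj u v := fun u v h1 h2 h3 => h1 ((hScl _ _ h3).2 h2)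
  have hl := fun v => G.loopless.irrefl v
  by_cases Sc : S c
  · have Sd := hScd.1 Sc
    by_cases Se : S e <;> by_cases Sh : S h
    · exact absurd (fun v => by
        rcases hall v with rfl | rfl | rfl | rfl | rfl | rfl <;> assumption) hcon'
    · exfalso
      exact flip_contra G H4 g hg b a hne hv' S hScl a c e h (by simp; grind)
        (by grind) (by grind) (by grind) (by grind)
    · exfalso
      exact flip_contra G H4 g hg a b hne.symm hv S hScl b d h e (by simp; grind)
        (by grind) (by grind) (by grind) (by grind)
    · have eh : G.Adj e h := by
        have := hall e'
        have := cross' e e' Se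
        grind
      refine four_iso_two G a b c d e h hq hall hab hcd eh nac nbd ?_ ?_
      · intro v hv; have := hall v; have := cross' e v Se; grind
      · intro v hv; have := hall v; have := cross' h v Sh; grind
  · have Sd : ¬ S d := fun h => Sc (hScd.2 h)
    by_cases Se : S e <;> by_cases Sh : S h
    · by_cases eh : G.Adj e h
      · refine four_iso_two G a b e h c d (by simp; grind) (by intro v; have := hall v; grind)
          hab eh hcd nae nbh ?_ ?_
        · intro v hv; have := hall v; have := cross' c v Sc; grind
        · intro v hv; have := hall v; have := cross' d v Sd; grind
      · have eb : G.Adj e b := by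
          have := hall e'
          have := cross e e' Se
          grind
        have ha : G.Adj a h := by
          have := hall h'
          have := cross h h' Sh
          grind
        refine four_iso_two G e b a h c d (by simp; grind) (by intro v; have := hall v; grind)
          eb ha hcd (by grind) nbh ?_ ?_
        · intro v hv; have := hall v; have := cross' c v Sc; grind
        · intro v hv; have := hall v; have := cross' d v Sd; grind
    · exfalso
      exact flip_contra G H4 g hg b a hne hv' S hScl a e d h (by simp; grind)
        (by grind) (by grind) (by grind) (by grind)
    · exfalso
      exact flip_contra G H4 g hg a b hne.symm hv S hScl b h c e (by simp; grind)
        (by grind) (by grind) (by grind) (by grind)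
    · by_cases eh : G.Adj e h
      · refine four_iso_two G c d e h a b (by simp; grind) (by intro v; have := hall v; grind)
          hcd eh hab nce ndh ?_ ?_
        · intro v hv; have := hall v; have := cross a v Sa; grind
        · intro v hv; have := hall v; have := cross b v Sb; grind
      · have ed : G.Adj e d := by
          have := hall e'
          have := cross' e e' Se
          grind
        have hch : G.Adj c h := by
          have := hall h'
          have := cross' h h' Sh
          grind
        refine four_iso_two G e d c h a b (by simp; grind) (by intro v; have := hall v; grind)
          ed hch hab (by grind) ndh ?_ ?_
        · intro v hv; have := hall v; have := cross a v Sa; grind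
        · intro v hv; have := hall v; have := cross b v Sb; grind

/-- The bipartite outcomes with a two-edge matching. -/
def BipListed (G : SimpleGraph V) : Prop :=
    (Fintype.card V = 6 ∧ G.Connected ∧ ∃ X : Finset V, X.card = 3 ∧
      ∀ ⦃u v⦄, G.Adj u v → (u ∈ X ↔ v ∉ X)) ∨
    Nonempty (G ≃g SimpleGraph.pathGraph 4) ∨
    Nonempty (G ≃g SimpleGraph.pathGraph 4 ⊕g (⊥ : SimpleGraph (Fin 1))) ∨
    Nonempty (G ≃g SimpleGraph.pathGraph 4 ⊕g (⊤ : SimpleGraph (Fin 2))) ∨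
    Nonempty (G ≃g SimpleGraph.cycleGraph 4) ∨
    Nonempty (G ≃g SimpleGraph.cycleGraph 4 ⊕g (⊥ : SimpleGraph (Fin 1))) ∨
    Nonempty (G ≃g SimpleGraph.cycleGraph 4 ⊕g (⊤ : SimpleGraph (Fin 2))) ∨
    Nonempty (G ≃g (⊤ : SimpleGraph (Fin 2)) ⊕g (⊤ : SimpleGraph (Fin 2))) ∨
    Nonempty (G ≃g ((⊤ : SimpleGraph (Fin 2)) ⊕g (⊤ : SimpleGraph (Fin 2)))
      ⊕g (⊤ : SimpleGraph (Fin 2))) ∨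
    Nonempty (G ≃g ((⊤ : SimpleGraph (Fin 2)) ⊕g (⊤ : SimpleGraph (Fin 2)))
      ⊕g (⊥ : SimpleGraph (Fin 1)))

theorem bip_five (G : SimpleGraph V) (hS : SwapProp G) (H4 : NoFour G) (g : V → ℕ)
    (hg : IsOptimalColoring G g) (a b c d e : V) (hq : [a, b, c, d, e].Nodup)
    (hc : g c = g a) (he : g e = g a) (hd : g d = g b) (hne : g b ≠ g a)
    (hv : ∀ v, g v = g a ∨ g v = g b)
    (hab : G.Adj a b) (hcd : G.Adj c d) : BipListed G := by
  have nadj : ∀ u v, g u = g v → ¬ G.Adj u v := fun u v h1 h2 => hg.1 h2 h1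
  have hq' := hq
  simp at hq'
  have nac := nadj a c hc.symm
  have nbd := nadj b d hd.symm
  by_cases hall : ∀ v, v = a ∨ v = b ∨ v = c ∨ v = d ∨ v = e
  · by_cases hiso : ∀ v, ¬ G.Adj e v
    · have := four_iso_one G a b c d e hq hall hab hcd nac nbd hiso
      unfold BipListed
      tauto
    · exfalso
      push Not at hiso
      obtain ⟨v, hev⟩ := hiso
      have h1 := nadj e a he
      have h2 := nadj e c (by rw [he, hc])
      have h3 := nadj e e rfl
      rcases hall v with rfl | rfl | rfl | rfl | rfl
      · exact h1 hev
      · exact no_order_five G hS g hg a v c d e hq hall hc he hd hne hab hev hcd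
      · exact h2 hev
      · refine no_order_five G hS g hg c v a b e (by simp; grind)
          (by intro v; have := hall v; grind) hc.symm (by rw [he, hc]) hd.symm ?_ hcd hev hab
        rw [hc, hd]; exact hne
      · exact h3 hev
  push Not at hall
  obtain ⟨h, hha, hhb, hhc, hhd, hhe⟩ := hall
  have hh : g h = g b := by
    rcases hv h with h' | h'
    · exact (H4 g hg a c e h (by simp; grind) hc he h').elim
    · exact h'
  have hall : ∀ v, v = a ∨ v = b ∨ v = c ∨ v = d ∨ v = e ∨ v = h := by
    intro v
    by_contra hn
    push Not at hn
    obtain ⟨n1, n2, n3, n4, n5, n6⟩ := hn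
    rcases hv v with h' | h'
    · exact (H4 g hg a c e v (by simp; grind) hc he h').elim
    · exact (H4 g hg b d h v (by simp; grind) hd hh h').elim
  have := bip_six G H4 g hg a b c d e h (by simp; grind) hc he hd hh hne hall hab hcd
  unfold BipListed
  rcases this with h | h | h | h
  · exact Or.inl h
  all_goals simp only [h, true_or, or_true]

theorem bip_four (G : SimpleGraph V) (hS : SwapProp G) (H4 : NoFour G) (g : V → ℕ)
    (hg : IsOptimalColoring G g) (a b c d : V) (hq : [a, b, c, d].Nodup)
    (hc : g c = g a) (hd : g d = g b) (hne : g b ≠ g a)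
    (hv : ∀ v, g v = g a ∨ g v = g b)
    (hab : G.Adj a b) (hcd : G.Adj c d) : BipListed G := by
  have nadj : ∀ u v, g u = g v → ¬ G.Adj u v := fun u v h1 h2 => hg.1 h2 h1
  have hq' := hq
  simp at hq'
  by_cases hall : ∀ v, v = a ∨ v = b ∨ v = c ∨ v = d
  · have := four_iso G a b c d hq hall hab hcd (nadj a c hc.symm) (nadj b d hd.symm)
    unfold BipListed
    tauto
  push Not at hall
  obtain ⟨e, h1, h2, h3, h4⟩ := hall
  rcases hv e with h | h
  · exact bip_five G hS H4 g hg a b c d e (by simp; grind) hc h hd hne hv hab hcd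
  · exact bip_five G hS H4 g hg b a d c e (by simp; grind) hd h hc hne.symm
      (fun v => (hv v).symm) hab.symm hcd.symm

theorem bip_case (G : SimpleGraph V) (hS : SwapProp G) (H4 : NoFour G)
    (hcol : G.Colorable 2) (a b c d : V) (hq : [a, b, c, d].Nodup)
    (hab : G.Adj a b) (hcd : G.Adj c d) : BipListed G := by
  obtain ⟨C⟩ := hcol
  let g : V → ℕ := fun v => (C v).val
  have hgp : IsProperColoring G g := by
    intro u v huv h
    exact C.valid huv (Fin.ext h)
  have h01 : ∀ v, g v = 0 ∨ g v = 1 := by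
    intro v
    have := (C v).isLt
    simp only [g]
    omega
  have hg := opt_of_two G g hgp h01 a b hab
  clear_value g
  have n1 := hgp hab
  have n2 := hgp hcd
  have hv : ∀ v, g v = g a ∨ g v = g b := by
    intro v
    have := h01 v
    have := h01 a
    have := h01 b
    omega
  have ha := h01 a
  have hb := h01 b
  have hc := h01 c
  have hd := h01 d
  simp at hq
  by_cases h : g c = g a
  · exact bip_four G hS H4 g hg a b c d (by simp; grind) h (by omega) n1.symm hv hab hcd
  · exact bip_four G hS H4 g hg a b d c (by simp; grind) (by omega) (by omega) n1.symm hv hab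
      hcd.symm

theorem three_pairs_nodup (g : V → ℕ) (q q' r r' s s' : V) (n1 : q ≠ q') (n2 : r ≠ r')
    (n3 : s ≠ s') (e1 : g q = g q') (e2 : g r = g r') (e3 : g s = g s') (k1 : g q ≠ g r)
    (k2 : g q ≠ g s) (k3 : g r ≠ g s) : [q, q', r, r', s, s'].Nodup := by
  simp
  refine ⟨⟨?_, ?_, ?_, ?_, ?_⟩, ⟨?_, ?_, ?_, ?_⟩, ⟨?_, ?_, ?_⟩, ⟨?_, ?_⟩, ?_⟩ <;> rintro rfl <;>
    first | contradiction | grind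

theorem third_color (G : SimpleGraph V) (hn : ¬ G.Colorable 2) (f : V → ℕ)
    (hf : IsProperColoring G f) (α β : ℕ) : ∃ r, f r ≠ α ∧ f r ≠ β := by
  by_contra hcon
  push Not at hcon
  apply hn
  refine ⟨SimpleGraph.Coloring.mk (fun v => if f v = α then (0 : Fin 2) else 1) ?_⟩
  intro u v huv
  have := hf huv
  have := hcon u
  have := hcon v
  split_ifs <;> simp <;> grind

theorem move (G : SimpleGraph V) (f : V → ℕ) (hf : IsOptimalColoring G f) (u w : V)
    (hne : f u ≠ f w) (h : ∀ x, f x = f w → ¬ G.Adj u x) :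
    IsOptimalColoring G (Function.update f u (f w)) ∧ ∃ x, x ≠ u ∧ f x = f u := by
  have hp : IsProperColoring G (Function.update f u (f w)) := by
    intro x y hxy
    have h0 := hf.1 hxy
    have hxy' := hxy.symm
    have h1 := h x
    have h2 := h y
    have := hxy.ne
    simp only [Function.update_apply]
    grind
  obtain ⟨h1, h2⟩ := opt_of_image G f _ hf hp (by
    intro v
    simp only [Function.update_apply]
    split_ifs
    exacts [⟨w, rfl⟩, ⟨v, rfl⟩])
  refine ⟨h1, ?_⟩
  obtain ⟨x, hx⟩ := h2 u
  simp only [Function.update_apply] at hx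
  refine ⟨x, ?_, ?_⟩ <;> grind

theorem two_single (G : SimpleGraph V) (f : V → ℕ) (hf : IsOptimalColoring G f) (u v p : V)
    (huv : u ≠ v) (hu : ∀ x, f x = f u → x = u) (hv : ∀ x, f x = f v → x = v)
    (hpu : f p ≠ f u) (hpv : f p ≠ f v) :
    G.Adj u v ∧ ∃ x, f x = f p ∧ G.Adj u x ∧ G.Adj v x := by
  classical
  constructor
  · by_contra hadj
    obtain ⟨-, x, hx, hx'⟩ := move G f hf u v (fun h => huv (hv u h))
      (by intro x hx; rw [hv x hx]; exact hadj)
    exact hx (hu x hx')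
  · by_contra hcon
    push Not at hcon
    let g : V → ℕ := fun x => if f x = f p then (if G.Adj u x then f v else f u) else f x
    have hp : IsProperColoring G g := by
      intro x y hxy
      have h0 := hf.1 hxy
      have hxy' := hxy.symm
      have a1 := hu x
      have a2 := hu y
      have a3 := hv x
      have a4 := hv y
      have h1 := hcon x
      have h2 := hcon y
      have : f u ≠ f v := fun h => huv (hv u h)
      simp only [g]
      by_cases hx : f x = f p <;> by_cases hy : f y = f p
      · grind
      · simp only [hx, hy, if_true, if_false]
        split_ifs <;> grind
      · simp only [hx, hy, if_true, if_false]
        split_ifs <;> grind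
      · simp only [hx, hy, if_false]; exact h0
    obtain ⟨h1, h2⟩ := opt_of_image G f g hf hp (by
      intro x
      simp only [g]
      split_ifs
      exacts [⟨v, rfl⟩, ⟨u, rfl⟩, ⟨x, rfl⟩])
    obtain ⟨x, hx⟩ := h2 p
    simp only [g] at hx
    split_ifs at hx <;> grind

theorem no_three_class (G : SimpleGraph V) (hS : SwapProp G) (H4 : NoFour G)
    (hn : ¬ G.Colorable 2) (f : V → ℕ) (hf : IsOptimalColoring G f) (p1 p2 p3 : V)
    (hp : [p1, p2, p3].Nodup) (h2 : f p2 = f p1) (h3 : f p3 = f p1) : False := by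
  classical
  have hp' := hp
  simp at hp'
  have tf : ∀ a b c, G.Adj a b → G.Adj b c → ¬ G.Adj c a := fun a b c hab hbc hca =>
    no_triangle G hS f hf p1 p2 p3 a b c hp h2 h3 hab hbc hca
  have single : ∀ u v, u ≠ v → f u ≠ f p1 → f v ≠ f p1 →
      (∃ x, x ≠ u ∧ f x = f u) ∨ (∃ x, x ≠ v ∧ f x = f v) := by
    intro u v huv hu hv
    by_contra hcon
    push Not at hcon
    obtain ⟨k1, x, -, k2, k3⟩ := two_single G f hf u v p1 huv
      (fun x hx => by by_contra h; exact hcon.1 x h hx)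
      (fun x hx => by by_contra h; exact hcon.2 x h hx) hu.symm hv.symm
    exact tf u v x k1 k3 k2.symm
  obtain ⟨r, r', hrr, hfr, hr1⟩ : ∃ r r', r ≠ r' ∧ f r = f r' ∧ f r ≠ f p1 := by
    obtain ⟨r1, hr1, -⟩ := third_color G hn f hf.1 (f p1) (f p1)
    obtain ⟨r2, hr2, hr2'⟩ := third_color G hn f hf.1 (f p1) (f r1)
    rcases single r1 r2 (by rintro rfl; exact hr2' rfl) hr1 hr2 with ⟨x, hx, hx'⟩ | ⟨x, hx, hx'⟩
    · exact ⟨r1, x, hx.symm, hx'.symm, hr1⟩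
    · exact ⟨r2, x, hx.symm, hx'.symm, hr2⟩
  rcases exists_oddcycle G hn with ⟨a, b, c, hab, hbc, hca⟩ |
    ⟨a, b, c, d, e, hq, hab, hbc, hcd, hde, hea⟩ | ⟨a, b, c, d, e, g, x, hq, hab, hcd, heg⟩
  · exact tf a b c hab hbc hca
  · exact no_five_cycle G hS f hf p1 p2 p3 r r' a b c d e (by simp; grind) h2.symm h3.symm hfr
      hq hab hbc hcd hde hea
  have hcard : 7 ≤ Fintype.card V := by
    simpa using List.Nodup.length_le_card hq
  have hq6 : [a, b, c, d, e, g].Nodup := by simp at hq ⊢; grind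
  clear hq
  have M3 : ∀ q q' r r' s s' (g' : V → ℕ), IsOptimalColoring G g' → q ≠ q' → r ≠ r' → s ≠ s' →
      g' q = g' q' → g' r = g' r' → g' s = g' s' → g' q ≠ g' r → g' q ≠ g' s → g' r ≠ g' s →
      False := by
    intro q q' r r' s s' g' hg' n1 n2 n3 e1 e2 e3 k1 k2 k3
    exact no_three_matching G hS g' hg' q q' r r' s s' a b c d e g
      (three_pairs_nodup g' q q' r r' s s' n1 n2 n3 e1 e2 e3 k1 k2 k3) e1 e2 e3
      hq6 hab hcd heg
  have third : ∀ t, f t ≠ f p1 → f t ≠ f r → ∀ x, f x = f t → x = t := by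
    intro t ht1 ht2 x hx
    by_contra hne
    exact M3 p1 p2 r r' t x f hf (by grind) hrr (Ne.symm hne) h2.symm hfr hx.symm hr1.symm
      ht1.symm ht2.symm
  obtain ⟨s, hs1, hsr⟩ := third_color G hn f hf.1 (f p1) (f r)
  have hs := third s hs1 hsr
  have hcl : ∀ v, f v = f p1 ∨ f v = f r ∨ v = s := by
    intro v
    by_contra hcon
    push Not at hcon
    obtain ⟨c1, c2, c3⟩ := hcon
    have hv := third v c1 c2
    rcases single v s c3 c1 hs1 with ⟨x, hx, hx'⟩ | ⟨x, hx, hx'⟩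
    · exact hx (hv x hx')
    · exact hx (hs x hx')
  obtain ⟨w, hws, hw⟩ : ∃ w, w ≠ s ∧ ¬ G.Adj w s := by
    by_contra hcon
    push Not at hcon
    apply hn
    refine ⟨SimpleGraph.Coloring.mk (fun v => if v = s then (0 : Fin 2) else 1) ?_⟩
    intro u v huv
    have := huv.ne
    have k1 := hcon u
    have k2 := hcon v
    have k3 := tf s u v
    have hc := G.adj_comm
    split_ifs <;> simp <;> grind
  have hfws : f w ≠ f s := fun h => hws (hs w h)
  obtain ⟨hg, -⟩ := move G f hf w s hfws (by intro x hx; rw [hs x hx]; exact hw)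
  have fin : ∀ q q' t t', q ≠ q' → t ≠ t' → q ≠ w → q' ≠ w → t ≠ w → t' ≠ w → f q = f p1 →
      f q' = f p1 → f t = f r → f t' = f r → False := by
    intro q q' t t' n1 n2 n3 n4 n5 n6 e1 e2 e3 e4
    refine M3 q q' t t' s w _ hg n1 n2 hws.symm ?_ ?_ ?_ ?_ ?_ ?_ <;>
      simp [Function.update_apply, *]
    · exact fun h => (hr1 (hfr.trans h.symm)).elim
    · exact fun h => (hs1 h.symm).elim
    · exact fun h => (hsr (h.symm.trans hfr.symm)).elim
  by_cases hwp : f w = f p1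
  · have hwr : w ≠ r := by rintro rfl; exact hr1 hwp
    have hwr' : w ≠ r' := by rintro rfl; exact hr1 (hfr.trans hwp)
    by_cases e1 : w = p1
    · exact fin p2 p3 r r' (by grind) hrr (by grind) (by grind) hwr.symm hwr'.symm h2 h3 rfl hfr.symm
    by_cases e2 : w = p2
    · exact fin p1 p3 r r' (by grind) hrr (by grind) (by grind) hwr.symm hwr'.symm rfl h3 rfl hfr.symm
    · exact fin p1 p2 r r' (by grind) hrr (by grind) (by grind) hwr.symm hwr'.symm rfl h2 rfl hfr.symm
  have hwr : f w = f r := by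
    have := hcl w
    grind
  obtain ⟨r'', n1, n2, e3⟩ : ∃ r'', r'' ≠ r ∧ r'' ≠ r' ∧ f r'' = f r := by
    by_contra hcon
    push Not at hcon
    have hall : (univ : Finset V) ⊆ {p1, p2, p3, r, r', s} := by
      intro v _
      simp
      by_contra hv
      push Not at hv
      obtain ⟨v1, v2, v3, v4, v5, v6⟩ := hv
      rcases hcl v with h | h | h
      · exact H4 f hf p1 p2 p3 v (by simp; grind) h2 h3 h
      · exact hcon v v4 v5 h
      · exact v6 h
    have := Finset.card_le_card hall
    have := Finset.card_le_six (a := p1) (b := p2) (c := p3) (d := r) (e := r') (f := s)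
    rw [Finset.card_univ] at *
    omega
  have k : p1 ≠ w ∧ p2 ≠ w := by grind
  have k1 : f p1 = f p1 := rfl
  by_cases e1 : w = r
  · exact fin p1 p2 r' r'' (by grind) n2.symm k.1 k.2 (by grind) (by grind) rfl h2 hfr.symm e3
  by_cases e2 : w = r'
  · exact fin p1 p2 r r'' (by grind) n1.symm k.1 k.2 (by grind) (by grind) rfl h2 rfl e3
  · exact fin p1 p2 r r' (by grind) hrr k.1 k.2 (by grind) (by grind) rfl h2 rfl hfr.symm

theorem one_pair_core (G : SimpleGraph V) (hS : SwapProp G) (f : V → ℕ)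
    (hf : IsOptimalColoring G f) (p q : V) (hpq : p ≠ q) (hfpq : f p = f q)
    (hcl : ∀ x y, x ≠ p → x ≠ q → y ≠ p → y ≠ q → x ≠ y → G.Adj x y)
    (hq : ∀ x, x ≠ p → x ≠ q → G.Adj q x)
    (a b : V) (ha : G.Adj p a) (hb : G.Adj p b) : a = b := by
  by_contra hab
  have npq : ¬ G.Adj p q := fun h => hf.1 h hfpq
  have haq : a ≠ q := by rintro rfl; exact npq ha
  have hbq : b ≠ q := by rintro rfl; exact npq hb
  have hc := G.adj_comm
  have ua : ∀ x, x ≠ a → G.Adj a x := by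
    intro x hx
    by_cases h1 : x = p
    · rw [h1]; exact ha.symm
    by_cases h2 : x = q
    · rw [h2]; exact (hq a ha.ne' haq).symm
    exact hcl a x ha.ne' haq h1 h2 (Ne.symm hx)
  have ub : ∀ x, x ≠ b → G.Adj b x := by
    intro x hx
    by_cases h1 : x = p
    · rw [h1]; exact hb.symm
    by_cases h2 : x = q
    · rw [h2]; exact (hq b hb.ne' hbq).symm
    exact hcl b x hb.ne' hbq h1 h2 (Ne.symm hx)
  obtain ⟨k, k', e1, -, -, e2, e3⟩ := swap_use G hS f hf ![p, q] ![a, b]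
    (inj_vec _ (by simpa using hpq)) (inj_vec _ (by simpa using hab))
  simp [Fin.forall_fin_succ] at e1
  rcases e3 with rfl | ⟨x, y, hxy, e4, e5, e6⟩
  · have := e2 a b (ua b (Ne.symm hab))
    grind
  · have := e6 a
    have := e6 b
    have n1 := e2 a b (ua b (Ne.symm hab))
    have n2 := fun h => e2 a x (ua x h)
    have n3 := fun h => e2 a y (ua y h)
    have n4 := fun h => e2 b x (ub x h)
    have n5 := fun h => e2 b y (ub y h)
    clear e6 e2 ua ub
    grind

theorem one_pair (G : SimpleGraph V) (hS : SwapProp G) (hn : ¬ G.Colorable 2) (f : V → ℕ)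
    (hf : IsOptimalColoring G f) (p q : V) (hpq : p ≠ q) (hfpq : f p = f q)
    (hone : ∀ x y, x ≠ y → f x = f y → f x = f p)
    (htwo : ∀ x, f x = f p → x = p ∨ x = q) :
    4 ≤ Fintype.card V ∧ ∃ v : V, (∀ a b, G.Adj v a → G.Adj v b → a = b) ∧
      ∀ a b : V, a ≠ v → b ≠ v → a ≠ b → G.Adj a b := by
  have npq : ¬ G.Adj p q := fun h => hf.1 h hfpq
  have nf : ∀ x, x ≠ p → x ≠ q → f x ≠ f p := by
    intro x h1 h2 h3
    have := htwo x h3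
    tauto
  have sing : ∀ x y, x ≠ p → x ≠ q → f y = f x → y = x := by
    intro x y h1 h2 h3
    by_contra h4
    exact nf x h1 h2 (hone x y (Ne.symm h4) h3.symm)
  have hcl : ∀ x y, x ≠ p → x ≠ q → y ≠ p → y ≠ q → x ≠ y → G.Adj x y := by
    intro x y h1 h2 h3 h4 h5
    exact (two_single G f hf x y p h5 (fun z hz => sing x z h1 h2 hz)
      (fun z hz => sing y z h3 h4 hz) (nf x h1 h2).symm (nf y h3 h4).symm).1
  refine ⟨?_, ?_⟩
  · obtain ⟨r, hr, -⟩ := third_color G hn f hf.1 (f p) (f p)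
    obtain ⟨s, hs, hs'⟩ := third_color G hn f hf.1 (f p) (f r)
    have : [p, q, r, s].Nodup := by simp; grind
    simpa using List.Nodup.length_le_card this
  have key : (∀ x, x ≠ p → x ≠ q → G.Adj q x) ∨ (∀ x, x ≠ p → x ≠ q → G.Adj p x) := by
    by_contra hcon
    push Not at hcon
    obtain ⟨⟨r', k1, k2, k3⟩, ⟨r, k4, k5, k6⟩⟩ := hcon
    let g : V → ℕ := fun x => if x = p then f r else if x = q then f r' else f x
    have hgp : IsProperColoring G g := by
      intro x y hxy
      have h0 := hf.1 hxy
      have hne := hxy.ne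
      have hc := G.adj_comm
      have a1 := sing r x k4 k5
      have a2 := sing r y k4 k5
      have a3 := sing r' x k1 k2
      have a4 := sing r' y k1 k2
      simp only [g]
      split_ifs <;> grind
    obtain ⟨-, h2⟩ := opt_of_image G f g hf hgp (by
      intro x
      simp only [g]
      split_ifs
      exacts [⟨r, rfl⟩, ⟨r', rfl⟩, ⟨x, rfl⟩])
    obtain ⟨x, hx⟩ := h2 p
    have m1 := nf r k4 k5
    have m2 := nf r' k1 k2
    have m3 := nf x
    simp only [g] at hx
    split_ifs at hx <;> grind
  have hc := G.adj_comm
  rcases key with hq | hq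
  · refine ⟨p, one_pair_core G hS f hf p q hpq hfpq hcl hq, ?_⟩
    intro a b h1 h2 h3
    by_cases e1 : a = q
    · subst e1; exact hq b h2 (Ne.symm h3)
    by_cases e2 : b = q
    · subst e2; exact (hq a h1 h3).symm
    exact hcl a b h1 e1 h2 e2 h3
  · refine ⟨q, one_pair_core G hS f hf q p hpq.symm hfpq.symm
      (fun x y h1 h2 h3 h4 => hcl x y h2 h1 h4 h3) (fun x h1 h2 => hq x h2 h1), ?_⟩
    intro a b h1 h2 h3
    by_cases e1 : a = p
    · subst e1; exact hq b (Ne.symm h3) h2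
    by_cases e2 : b = p
    · subst e2; exact (hq a h3 h1).symm
    exact hcl a b e1 h1 e2 h2 h3

/-- No optimal coloring has a color class with three vertices. -/
def NoThree (G : SimpleGraph V) : Prop :=
  ∀ g : V → ℕ, IsOptimalColoring G g → ∀ p1 p2 p3 : V, [p1, p2, p3].Nodup →
    g p2 = g p1 → g p3 = g p1 → False

theorem tri_comp (G : SimpleGraph V)
    (E2 : ∀ a b c d, [a, b, c, d].Nodup → G.Adj a b → G.Adj c d →
      (¬ G.Adj a c ∧ ¬ G.Adj b d) ∨ (¬ G.Adj a d ∧ ¬ G.Adj b c))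
    (a b c d : V) (hab : G.Adj a b) (hbc : G.Adj b c) (hca : G.Adj c a) (h : G.Adj a d) :
    d = b ∨ d = c := by
  by_contra hcon
  have := hab.ne
  have := hbc.ne
  have := hca.ne
  have := h.ne
  have := E2 a d b c (by simp; grind) h hbc
  have := hca.symm
  tauto

theorem two_pairs_five (G : SimpleGraph V) (hn : ¬ G.Colorable 2)
    (E2 : ∀ a b c d, [a, b, c, d].Nodup → G.Adj a b → G.Adj c d →
      (¬ G.Adj a c ∧ ¬ G.Adj b d) ∨ (¬ G.Adj a d ∧ ¬ G.Adj b c))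
    (NI : ∀ u, ∃ v, G.Adj u v) (hcard : Fintype.card V = 5) :
    Nonempty (G ≃g SimpleGraph.cycleGraph 5) ∨
    Nonempty (G ≃g (⊤ : SimpleGraph (Fin 3)) ⊕g (⊤ : SimpleGraph (Fin 2))) := by
  by_cases ht : ∀ x y z, G.Adj x y → G.Adj y z → ¬ G.Adj z x
  · rcases exists_oddcycle G hn with ⟨a, b, c, hab, hbc, hca⟩ |
      ⟨a, b, c, d, e, hq, hab, hbc, hcd, hde, hea⟩ | ⟨a, b, c, d, e, g, x, hq, hab, hcd, heg⟩
    · exact (ht a b c hab hbc hca).elim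
    · left
      refine five_cycle_iso G a b c d e hq ?_ hab hbc hcd hde hea ht
      intro v
      have : ({a, b, c, d, e} : Finset V) = univ := by
        apply Finset.eq_univ_of_card
        rw [hcard]
        simp at hq
        simp [Finset.card_insert_of_notMem, hq]
      have := this ▸ Finset.mem_univ v
      simpa using this
    · have := List.Nodup.length_le_card hq
      simp at this
      omega
  · right
    push Not at ht
    obtain ⟨a, b, c, hab, hbc, hca⟩ := ht
    have n1 := hab.ne
    have n2 := hbc.ne
    have n3 := hca.ne
    have h3 : ({a, b, c} : Finset V).card = 3 := by
      have := n3.symm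
      simp [Finset.card_insert_of_notMem, *]
    have h2 : (({a, b, c} : Finset V)ᶜ).card = 2 := by
      rw [Finset.card_compl, hcard, h3]
    obtain ⟨d, e, hde, heq⟩ := Finset.card_eq_two.1 h2
    have hmem : ∀ v, (¬ (v = a ∨ v = b ∨ v = c)) ↔ (v = d ∨ v = e) := by
      intro v
      have : v ∈ (({a, b, c} : Finset V)ᶜ) ↔ v ∈ ({d, e} : Finset V) := by rw [heq]
      simpa using this
    have hd := (hmem d).2 (Or.inl rfl)
    have he := (hmem e).2 (Or.inr rfl)
    have t1 := fun v => tri_comp G E2 a b c v hab hbc hca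
    have t2 := fun v => tri_comp G E2 b c a v hbc hca hab
    have t3 := fun v => tri_comp G E2 c a b v hca hab hbc
    have hc := G.adj_comm
    have hl := fun v => G.loopless.irrefl v
    have d1 : ∀ v, G.Adj d v → v = e := by
      intro v hv
      have hnT : ¬ (v = a ∨ v = b ∨ v = c) := by
        rintro (rfl | rfl | rfl)
        · have := t1 d hv.symm; tauto
        · have := t2 d hv.symm; tauto
        · have := t3 d hv.symm; tauto
      have := hv.ne'
      have := (hmem v).1 hnT
      tauto
    have e1 : ∀ v, G.Adj e v → v = d := by
      intro v hv
      have hnT : ¬ (v = a ∨ v = b ∨ v = c) := by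
        rintro (rfl | rfl | rfl)
        · have := t1 e hv.symm; tauto
        · have := t2 e hv.symm; tauto
        · have := t3 e hv.symm; tauto
      have := hv.ne'
      have := (hmem v).1 hnT
      tauto
    obtain ⟨v, hv⟩ := NI d
    have : G.Adj d e := by rw [← d1 v hv]; exact hv
    refine tri_edge_iso G a b c d e (by simp; grind) ?_ hab hbc hca this d1 e1
    intro v
    have := hmem v
    grind

set_option maxHeartbeats 1000000 in
theorem three_pairs_case (G : SimpleGraph V) (H3 : NoThree G) (hn : ¬ G.Colorable 2)
    (E2 : ∀ a b c d, [a, b, c, d].Nodup → G.Adj a b → G.Adj c d →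
      (¬ G.Adj a c ∧ ¬ G.Adj b d) ∨ (¬ G.Adj a d ∧ ¬ G.Adj b c))
    (NI : ∀ u, ∃ v, G.Adj u v) (hcard : 6 ≤ Fintype.card V)
    (M3 : ∀ a b c d e g, [a, b, c, d, e, g].Nodup → G.Adj a b → G.Adj c d → G.Adj e g → False) :
    Nonempty (G ≃g (⊤ : SimpleGraph (Fin 3)) ⊕g (⊤ : SimpleGraph (Fin 3))) := by
  have avoid5 : ∀ a b c d e : V, ∃ w, w ≠ a ∧ w ≠ b ∧ w ≠ c ∧ w ≠ d ∧ w ≠ e := by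
    intro a b c d e
    by_contra hcon
    push Not at hcon
    have hall : (univ : Finset V) ⊆ {a, b, c, d, e} := by
      intro v _
      have := hcon v
      simp
      tauto
    have := Finset.card_le_card hall
    have := Finset.card_le_five (a := a) (b := b) (c := c) (d := d) (e := e)
    rw [Finset.card_univ] at *
    omega
  have hc := G.adj_comm
  have hl := fun v => G.loopless.irrefl v
  rcases exists_oddcycle G hn with ⟨a, b, c, hab, hbc, hca⟩ |
      ⟨a, b, c, d, e, hq, hab, hbc, hcd, hde, hea⟩ | ⟨a, b, c, d, e, g, x, hq, hab, hcd, heg⟩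
  rotate_left
  · exfalso
    obtain ⟨w, w1, w2, w3, w4, w5⟩ := avoid5 a b c d e
    obtain ⟨v, hv⟩ := NI w
    have hwv := hv.ne
    simp at hq
    by_cases va : v = a
    · subst va; exact M3 w v b c d e (by simp; grind) hv hbc hde
    by_cases vb : v = b
    · subst vb; exact M3 w v c d e a (by simp; grind) hv hcd hea
    by_cases vc : v = c
    · subst vc; exact M3 w v d e a b (by simp; grind) hv hde hab
    by_cases vd : v = d
    · subst vd; exact M3 w v e a b c (by simp; grind) hv hea hbc
    by_cases ve : v = e
    · subst ve; exact M3 w v a b c d (by simp; grind) hv hab hcd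
    exact M3 w v a b c d (by simp; grind) hv hab hcd
  · exact (M3 a b c d e g (by simp at hq ⊢; grind) hab hcd heg).elim
  have t1 := fun v => tri_comp G E2 a b c v hab hbc hca
  have t2 := fun v => tri_comp G E2 b c a v hbc hca hab
  have t3 := fun v => tri_comp G E2 c a b v hca hab hbc
  have n1 := hab.ne
  have n2 := hbc.ne
  have n3 := hca.ne
  have out : ∀ u v, (u ≠ a ∧ u ≠ b ∧ u ≠ c) → G.Adj u v → (v ≠ a ∧ v ≠ b ∧ v ≠ c) := by
    intro u v hu huv
    refine ⟨?_, ?_, ?_⟩ <;> rintro rfl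
    · have := t1 u huv.symm; tauto
    · have := t2 u huv.symm; tauto
    · have := t3 u huv.symm; tauto
  have meet : ∀ u v x y, (u ≠ a ∧ u ≠ b ∧ u ≠ c) → (x ≠ a ∧ x ≠ b ∧ x ≠ c) → G.Adj u v →
      G.Adj x y → u = x ∨ u = y ∨ v = x ∨ v = y := by
    intro u v x y hu hx huv hxy
    by_contra hcon
    have hv := out u v hu huv
    have hy := out x y hx hxy
    have := huv.ne
    have := hxy.ne
    push Not at hcon
    obtain ⟨c1, c2, c3, c4⟩ := hcon
    obtain ⟨u1, u2, u3⟩ := hu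
    obtain ⟨v1, v2, v3⟩ := hv
    obtain ⟨x1, x2, x3⟩ := hx
    obtain ⟨y1, y2, y3⟩ := hy
    exact M3 a b u v x y (by simp; grind) hab huv hxy
  obtain ⟨d, d1, d2, d3, -, -⟩ := avoid5 a b c c c
  have dout : d ≠ a ∧ d ≠ b ∧ d ≠ c := ⟨d1, d2, d3⟩
  obtain ⟨e, hde⟩ := NI d
  have eout := out d e dout hde
  obtain ⟨r, r1, r2, r3, r4, r5⟩ := avoid5 a b c d e
  have rout : r ≠ a ∧ r ≠ b ∧ r ≠ c := ⟨r1, r2, r3⟩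
  obtain ⟨r', hrr⟩ := NI r
  have hor : G.Adj r d ∨ G.Adj r e := by
    have := meet d e r r' dout rout hde hrr
    grind
  -- main claim with the center named
  have main : ∀ d e, (d ≠ a ∧ d ≠ b ∧ d ≠ c) → (e ≠ a ∧ e ≠ b ∧ e ≠ c) → G.Adj d e → r ≠ d →
      r ≠ e → G.Adj r d → ¬ G.Adj r e → False := by
    intro d e dout eout hde r4 r5 hrd hre
    have star : ∀ u v, (u ≠ a ∧ u ≠ b ∧ u ≠ c) → G.Adj u v → u = d ∨ v = d := by
      intro u v hu huv
      have m1 := meet u v d e hu dout huv hde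
      have m2 := meet u v r d hu rout huv hrd
      have := hl u
      by_contra hcon
      push Not at hcon
      obtain ⟨c1, c2⟩ := hcon
      have h1 : u = e ∨ v = e := by tauto
      have h2 : u = r ∨ v = r := by tauto
      rcases h1 with rfl | rfl <;> rcases h2 with rfl | rfl
      · exact r5 rfl
      · exact hre huv.symm
      · exact hre huv
      · exact r5 rfl
    let g : V → ℕ := fun v => if v = a then 0 else if v = b ∨ v = d then 1 else
      if v = c then 2 else 0
    have hgp : IsProperColoring G g := by
      intro u v huv
      have hne := huv.ne
      by_cases hu : u ≠ a ∧ u ≠ b ∧ u ≠ c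
      · have hv := out u v hu huv
        have := star u v hu huv
        simp only [g]
        grind
      · have hv : ¬ (v ≠ a ∧ v ≠ b ∧ v ≠ c) := fun h => hu (out v u h huv.symm)
        simp only [g]
        grind
    have hg : IsOptimalColoring G g := by
      apply opt_of_le G g hgp
      have h3 : 3 ≤ chromNum G := by
        by_contra h
        exact hn ((chrom_colorable G).mono (by omega))
      refine le_trans (Finset.card_le_card (t := {0, 1, 2}) ?_) (le_trans ?_ h3)
      · intro x
        simp only [Finset.mem_image, Finset.mem_univ, true_and]
        rintro ⟨v, rfl⟩
        simp only [g]
        split_ifs <;> simp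
      · simp
    have := hde.ne
    refine H3 g hg a e r (by simp; grind) ?_ ?_ <;> simp only [g] <;> grind
  by_cases hd : G.Adj r d
  · by_cases he : G.Adj r e
    · have t4 := fun v => tri_comp G E2 d e r v hde he.symm hd
      have t5 := fun v => tri_comp G E2 e r d v he.symm hd hde
      have t6 := fun v => tri_comp G E2 r d e v hd hde he.symm
      have hall : ∀ v, v = a ∨ v = b ∨ v = c ∨ v = d ∨ v = e ∨ v = r := by
        intro v
        by_contra hcon
        push Not at hcon
        obtain ⟨v1, v2, v3, v4, v5, v6⟩ := hcon
        obtain ⟨w, hw⟩ := NI v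
        have m1 := meet v w d e ⟨v1, v2, v3⟩ dout hw hde
        have m2 := t4 v
        have m3 := t5 v
        have := hw.symm
        rcases m1 with rfl | rfl | rfl | rfl
        · exact v4 rfl
        · exact v5 rfl
        · have := t4 v hw.symm; tauto
        · have := t5 v hw.symm; tauto
      have := hde.ne
      exact tri_tri_iso G a b c d e r (by simp; grind) hall hab hbc hca hde he.symm hd
        t1 (fun v hv => (t2 v hv).symm) t3
    · exact (main d e dout eout hde r4 r5 hd he).elim
  · exact (main e d eout dout hde.symm r5 r4 (by tauto) hd).elim

theorem nonbip_case (G : SimpleGraph V) (hS : SwapProp G) (H4 : NoFour G)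
    (hn : ¬ G.Colorable 2) (f : V → ℕ) (hf : IsOptimalColoring G f)
    (hinj : ¬ Function.Injective f) :
    (4 ≤ Fintype.card V ∧ ∃ v : V, (∀ a b, G.Adj v a → G.Adj v b → a = b) ∧
      ∀ a b : V, a ≠ v → b ≠ v → a ≠ b → G.Adj a b) ∨
    Nonempty (G ≃g SimpleGraph.cycleGraph 5) ∨
    Nonempty (G ≃g (⊤ : SimpleGraph (Fin 3)) ⊕g (⊤ : SimpleGraph (Fin 2))) ∨
    Nonempty (G ≃g (⊤ : SimpleGraph (Fin 3)) ⊕g (⊤ : SimpleGraph (Fin 3))) := by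
  have H3 : NoThree G := fun g hg p1 p2 p3 hp h2 h3 =>
    no_three_class G hS H4 hn g hg p1 p2 p3 hp h2 h3
  have H3' : ∀ p q x, p ≠ q → f p = f q → f x = f p → x = p ∨ x = q := by
    intro p q x hpq h1 h2
    by_contra hcon
    exact H3 f hf p q x (by simp; grind) h1.symm h2
  simp only [Function.Injective] at hinj
  push Not at hinj
  obtain ⟨p, q, hfpq, hpq⟩ := hinj
  by_cases hone : ∀ x y, x ≠ y → f x = f y → f x = f p
  · left
    exact one_pair G hS hn f hf p q hpq hfpq hone (fun x hx => H3' p q x hpq hfpq hx)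
  right
  push Not at hone
  obtain ⟨p', q', hpq', hfpq', hne⟩ := hone
  have nd4 : [p, q, p', q'].Nodup := by simp; grind
  have E2 : ∀ a b c d, [a, b, c, d].Nodup → G.Adj a b → G.Adj c d →
      (¬ G.Adj a c ∧ ¬ G.Adj b d) ∨ (¬ G.Adj a d ∧ ¬ G.Adj b c) := by
    intro a b c d hq hab hcd
    exact two_edges G hS f hf p q p' q' a b c d nd4 hfpq hfpq' hq hab hcd
  have NI : ∀ u, ∃ v, G.Adj u v := by
    intro u
    by_contra hu
    push Not at hu
    by_cases h : f u = f p
    · have h' : f u ≠ f p' := by rw [h]; exact hne.symm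
      have hup : u ≠ p' := by rintro rfl; exact h' rfl
      have huq : u ≠ q' := by rintro rfl; exact h' hfpq'.symm
      obtain ⟨hg, -⟩ := move G f hf u p' h' (fun x _ => hu x)
      refine H3 _ hg p' q' u (by simp; grind) ?_ ?_ <;>
        simp [Function.update_apply, hup.symm, huq.symm, hfpq']
    · have hup : u ≠ p := by rintro rfl; exact h rfl
      have huq : u ≠ q := by rintro rfl; exact h hfpq.symm
      obtain ⟨hg, -⟩ := move G f hf u p h (fun x _ => hu x)
      refine H3 _ hg p q u (by simp; grind) ?_ ?_ <;>
        simp [Function.update_apply, hup.symm, huq.symm, hfpq]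
  have S1 : ∀ w w', (∀ x, f x = f w → x = w) → (∀ x, f x = f w' → x = w') → f w ≠ f p →
      f w ≠ f p' → f w' ≠ f p → f w' ≠ f p' → w = w' := by
    intro w w' h1 h2 k1 k2 k3 k4
    by_contra hww
    obtain ⟨hadj, x, hx, hwx, hwx'⟩ := two_single G f hf w w' p hww h1 h2 k1.symm k3.symm
    obtain ⟨-, y, hy, hwy, hwy'⟩ := two_single G f hf w w' p' hww h1 h2 k2.symm k4.symm
    have := E2 w x w' y (by
      have := hwx.ne
      have := hwx'.ne
      have := hwy.ne
      have := hwy'.ne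
      have : x ≠ y := by rintro rfl; exact hne (hy.symm.trans hx)
      simp; grind) hwx hwy'
    tauto
  by_cases hth : ∃ x y, x ≠ y ∧ f x = f y ∧ f x ≠ f p ∧ f x ≠ f p'
  · right; right
    obtain ⟨x, y, hxy, hfxy, hx1, hx2⟩ := hth
    have nd := three_pairs_nodup f p q p' q' x y hpq hpq' hxy hfpq hfpq' hfxy hne.symm hx1.symm
      hx2.symm
    refine three_pairs_case G H3 hn E2 NI (by simpa using List.Nodup.length_le_card nd) ?_
    intro a b c d e g hq hab hcd heg
    exact no_three_matching G hS f hf p q p' q' x y a b c d e g nd hfpq hfpq' hfxy hq hab hcd heg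
  · push Not at hth
    have hsing : ∀ x, f x ≠ f p → f x ≠ f p' → ∀ y, f y = f x → y = x := by
      intro x h1 h2 y hy
      by_contra h
      exact h2 (hth x y (Ne.symm h) hy.symm h1)
    obtain ⟨s, hs1, hs2⟩ := third_color G hn f hf.1 (f p) (f p')
    have hall : (univ : Finset V) = {p, q, p', q', s} := by
      ext v
      simp
      by_cases h1 : f v = f p
      · have := H3' p q v hpq hfpq h1; tauto
      by_cases h2 : f v = f p'
      · have := H3' p' q' v hpq' hfpq' h2; tauto
      have := S1 v s (hsing v h1 h2) (hsing s hs1 hs2) h1 h2 hs1 hs2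
      tauto
    have hcard : Fintype.card V = 5 := by
      have m1 : s ≠ p := by rintro rfl; exact hs1 rfl
      have m2 : s ≠ q := by rintro rfl; exact hs1 hfpq.symm
      have m3 : s ≠ p' := by rintro rfl; exact hs2 rfl
      have m4 : s ≠ q' := by rintro rfl; exact hs2 hfpq'.symm
      have : [p, q, p', q', s].Nodup := by simp at nd4 ⊢; grind
      apply le_antisymm
      · rw [← Finset.card_univ, hall]
        exact Finset.card_le_five
      · simpa using List.Nodup.length_le_card this
    have := two_pairs_five G hn E2 NI hcard
    tauto

theorem villainy_eq_two_characterization (G : SimpleGraph V)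
    [DecidableRel G.Adj] (hB : villainy G = 2) :
    -- (1) a star K_{1,t} with t ≥ 2
    (∃ t : ℕ, 2 ≤ t ∧ Nonempty (G ≃g starGraph t)) ∨
    -- (2) a connected bipartite graph on 6 vertices with parts of size 3
    (Fintype.card V = 6 ∧ G.Connected ∧ ∃ X : Finset V, X.card = 3 ∧
      ∀ ⦃u v⦄, G.Adj u v → (u ∈ X ↔ v ∉ X)) ∨
    -- (3) P₄, P₄ + K₁, P₄ + K₂
    Nonempty (G ≃g SimpleGraph.pathGraph 4) ∨
    Nonempty (G ≃g SimpleGraph.pathGraph 4 ⊕g (⊥ : SimpleGraph (Fin 1))) ∨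
    Nonempty (G ≃g SimpleGraph.pathGraph 4 ⊕g (⊤ : SimpleGraph (Fin 2))) ∨
    -- (4) C₄, C₄ + K₁, C₄ + K₂
    Nonempty (G ≃g SimpleGraph.cycleGraph 4) ∨
    Nonempty (G ≃g SimpleGraph.cycleGraph 4 ⊕g (⊥ : SimpleGraph (Fin 1))) ∨
    Nonempty (G ≃g SimpleGraph.cycleGraph 4 ⊕g (⊤ : SimpleGraph (Fin 2))) ∨
    -- (5) C₅
    Nonempty (G ≃g SimpleGraph.cycleGraph 5) ∨
    -- (6) K₂ + K₂, K₂ + K₂ + K₂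
    Nonempty (G ≃g (⊤ : SimpleGraph (Fin 2)) ⊕g (⊤ : SimpleGraph (Fin 2))) ∨
    Nonempty (G ≃g ((⊤ : SimpleGraph (Fin 2)) ⊕g (⊤ : SimpleGraph (Fin 2)))
      ⊕g (⊤ : SimpleGraph (Fin 2))) ∨
    -- (7) K₃ + K₂
    Nonempty (G ≃g (⊤ : SimpleGraph (Fin 3)) ⊕g (⊤ : SimpleGraph (Fin 2))) ∨
    -- (8) K₃ + K₃
    Nonempty (G ≃g (⊤ : SimpleGraph (Fin 3)) ⊕g (⊤ : SimpleGraph (Fin 3))) ∨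
    -- (9) K₂ + K₂ + K₁
    Nonempty (G ≃g ((⊤ : SimpleGraph (Fin 2)) ⊕g (⊤ : SimpleGraph (Fin 2)))
      ⊕g (⊥ : SimpleGraph (Fin 1))) ∨
    -- (10) a vertex v of degree ≤ 1 with G - v complete, n(G) ≥ 4
    (4 ≤ Fintype.card V ∧ ∃ v : V, G.degree v ≤ 1 ∧
      ∀ a b : V, a ≠ v → b ≠ v → a ≠ b → G.Adj a b) ∨
    -- (11) P₃ + rK₁ with r ≥ 1
    (∃ r : ℕ, 1 ≤ r ∧
      Nonempty (G ≃g SimpleGraph.pathGraph 3 ⊕g (⊥ : SimpleGraph (Fin r)))) ∨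
    -- (12) K₂ + rK₁ with r ≥ 1
    (∃ r : ℕ, 1 ≤ r ∧
      Nonempty (G ≃g (⊤ : SimpleGraph (Fin 2)) ⊕g (⊥ : SimpleGraph (Fin r)))) := by
  obtain ⟨hS, f, hf, hinj, u, v, huv⟩ := setup_swap G hB
  have hinj' := hinj
  simp only [Function.Injective] at hinj'
  push Not at hinj'
  obtain ⟨p, q, hfpq, hpq⟩ := hinj'
  obtain ⟨w, hwu, hwv⟩ : ∃ w, w ≠ u ∧ w ≠ v := by
    have h0 := hf.1 huv
    by_cases h : p ≠ u ∧ p ≠ v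
    · exact ⟨p, h⟩
    · refine ⟨q, ?_, ?_⟩ <;> rintro rfl <;> grind
  -- the non-star part
  have rest : NoFour G → (∀ a b c, G.Adj a b → G.Adj b c → G.Adj c a → ¬ G.Colorable 2) →
      (G.Colorable 2 → ∃ a b c d, [a, b, c, d].Nodup ∧ G.Adj a b ∧ G.Adj c d) →
      BipListed G ∨ ((4 ≤ Fintype.card V ∧ ∃ v : V, G.degree v ≤ 1 ∧
        ∀ a b : V, a ≠ v → b ≠ v → a ≠ b → G.Adj a b) ∨
      Nonempty (G ≃g SimpleGraph.cycleGraph 5) ∨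
      Nonempty (G ≃g (⊤ : SimpleGraph (Fin 3)) ⊕g (⊤ : SimpleGraph (Fin 2))) ∨
      Nonempty (G ≃g (⊤ : SimpleGraph (Fin 3)) ⊕g (⊤ : SimpleGraph (Fin 3)))) := by
    intro H4 _ hm
    by_cases hcol : G.Colorable 2
    · obtain ⟨a, b, c, d, hq, hab, hcd⟩ := hm hcol
      exact Or.inl (bip_case G hS H4 hcol a b c d hq hab hcd)
    · right
      rcases nonbip_case G hS H4 hcol f hf hinj with ⟨h1, v, h2, h3⟩ | h
      · left
        refine ⟨h1, v, ?_, h3⟩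
        rw [← SimpleGraph.card_neighborFinset_eq_degree, Finset.card_le_one]
        intro a ha b hb
        rw [SimpleGraph.mem_neighborFinset] at ha hb
        exact h2 a b ha hb
      · exact Or.inr h
  have tri : ∀ a b c, G.Adj a b → G.Adj b c → G.Adj c a → ¬ G.Colorable 2 := by
    rintro a b c hab hbc hca ⟨C⟩
    have h1 := C.valid hab
    have h2 := C.valid hbc
    have h3 := C.valid hca
    omega
  have fin : (NoFour G ∧
      (G.Colorable 2 → ∃ a b c d, [a, b, c, d].Nodup ∧ G.Adj a b ∧ G.Adj c d)) ∨
      ∃ z, ∀ u v, G.Adj u v → u = z ∨ v = z := by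
    rcases star_or G u v huv with h | h | h
    · refine Or.inl ⟨noFour_of G hS (Or.inl h), fun hcol => ?_⟩
      obtain ⟨a, b, c, hab, hbc, hca⟩ := h
      exact (tri a b c hab hbc hca hcol).elim
    · exact Or.inl ⟨noFour_of G hS (Or.inr h), fun _ => h⟩
    · exact Or.inr h
  rcases fin with ⟨H4, hm⟩ | ⟨z, hz⟩
  · rcases rest H4 tri hm with h | h | h | h | h
    · unfold BipListed at h
      rcases h with h | h | h | h | h | h | h | h | h | h
      · exact Or.inr (Or.inl h)
      all_goals simp only [h, true_or, or_true]
    · have h' := h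
      iterate 14 right
      exact Or.inl h
    all_goals simp only [h, true_or, or_true]
  · rcases star_case G hS z hz u v huv w hwu hwv with h | h | h
    · exact Or.inl h
    · iterate 15 right
      exact Or.inl h
    · iterate 16 right
      exact h
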